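/- Assume a ∈ K̂ with a > 0 on the closure of A and p > 2. Let α ∈ (1, 2N/(N−2)) and β > max{N, 1/(p−2)} satisfy 1/α + 1/β + 1/2 = 1. Then for every M > 0 there exists C' > 0 such that: whenever u, ū ∈ K satisfy ‖u‖_{H¹(A)} ≤ M and ‖ū‖_{H¹(A)} ≤ M, and v, v̄ are C² functions on the closure of A vanishing on ∂A with −Δv + v = a(x)u(x)^{p−1} and −Δv̄ + v̄ = a(x)ū(x)^{p−1} pointwise in A, one has ‖v − v̄‖_{H¹(A)} ≤ C' (∫_A |u − ū|^α dx)^{1/α}. -/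

import Mathlib

open MeasureTheory Real Set

noncomputable section

/-- The open annulus `{x : R₀ < |x| < R₁}` in `ℝ^N`. -/
def annulus (N : ℕ) (R₀ R₁ : ℝ) : Set (EuclideanSpace ℝ (Fin N)) :=
  {x | R₀ < ‖x‖ ∧ ‖x‖ < R₁}

/-- The last coordinate `x_N` of a point of `ℝ^N`. -/
def lastCoord {N : ℕ} (x : EuclideanSpace ℝ (Fin N)) : ℝ :=
  if h : 0 < N then x ⟨N - 1, by omega⟩ else 0

/-- The polar angle `θ = arcsin (x_N / |x|)`. -/
def angleOf {N : ℕ} (x : EuclideanSpace ℝ (Fin N)) : ℝ :=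
  Real.arcsin (lastCoord x / ‖x‖)

/-- `u` is axially symmetric on the closed annulus with representative `𝔲 = 𝔲(r,θ)`. -/
def IsAxiallySymmRep (N : ℕ) (R₀ R₁ : ℝ) (u : EuclideanSpace ℝ (Fin N) → ℝ)
    (𝔲 : ℝ → ℝ → ℝ) : Prop :=
  ∀ x ∈ closure (annulus N R₀ R₁), u x = 𝔲 ‖x‖ (angleOf x)

/-- Membership in the cone `K̂`: `C¹` on the closed annulus, nonnegative, axially symmetric,
even in `θ` and nonincreasing in `θ` on `[0, π/2]`. -/
def memKhat (N : ℕ) (R₀ R₁ : ℝ) (u : EuclideanSpace ℝ (Fin N) → ℝ) : Prop :=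
  ContDiffOn ℝ 1 u (closure (annulus N R₀ R₁)) ∧
  (∀ x ∈ closure (annulus N R₀ R₁), 0 ≤ u x) ∧
  ∃ 𝔲 : ℝ → ℝ → ℝ,
    IsAxiallySymmRep N R₀ R₁ u 𝔲 ∧
    (∀ r ∈ Icc R₀ R₁, ∀ θ ∈ Icc (-(π / 2)) (π / 2), 𝔲 r (-θ) = 𝔲 r θ) ∧
    (∀ r ∈ Icc R₀ R₁, AntitoneOn (𝔲 r) (Icc 0 (π / 2)))

/-- `C¹₀(A)` : `C¹` on the closed annulus, vanishing on the boundary. -/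
def memC10 (N : ℕ) (R₀ R₁ : ℝ) (u : EuclideanSpace ℝ (Fin N) → ℝ) : Prop :=
  ContDiffOn ℝ 1 u (closure (annulus N R₀ R₁)) ∧
  ∀ x : EuclideanSpace ℝ (Fin N), (‖x‖ = R₀ ∨ ‖x‖ = R₁) → u x = 0

/-- The cone `K = K̂ ∩ C¹₀(A)`. -/
def memK (N : ℕ) (R₀ R₁ : ℝ) (u : EuclideanSpace ℝ (Fin N) → ℝ) : Prop :=
  memKhat N R₀ R₁ u ∧ ∀ x : EuclideanSpace ℝ (Fin N), (‖x‖ = R₀ ∨ ‖x‖ = R₁) → u x = 0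

/-- The squared `H¹(A)`-norm `∫_A (|∇u|² + u²) dx`. -/
def H1sq (N : ℕ) (R₀ R₁ : ℝ) (u : EuclideanSpace ℝ (Fin N) → ℝ) : ℝ :=
  ∫ x in annulus N R₀ R₁,
    (‖fderivWithin ℝ u (closure (annulus N R₀ R₁)) x‖ ^ 2 + (u x) ^ 2)

/-- The energy functional `I(u) = ½‖u‖²_{H¹} − (1/p) ∫_A a |u|^p`. -/
def funcI (N : ℕ) (R₀ R₁ : ℝ) (a : EuclideanSpace ℝ (Fin N) → ℝ) (p : ℝ)
    (u : EuclideanSpace ℝ (Fin N) → ℝ) : ℝ :=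
  (1 / 2) * H1sq N R₀ R₁ u - (1 / p) * ∫ x in annulus N R₀ R₁, a x * |u x| ^ p

/-- The Nehari set `N_K`. -/
def memNehari (N : ℕ) (R₀ R₁ : ℝ) (a : EuclideanSpace ℝ (Fin N) → ℝ) (p : ℝ)
    (u : EuclideanSpace ℝ (Fin N) → ℝ) : Prop :=
  memK N R₀ R₁ u ∧ (∃ x ∈ annulus N R₀ R₁, u x ≠ 0) ∧
  H1sq N R₀ R₁ u = ∫ x in annulus N R₀ R₁, a x * |u x| ^ p

/-- The Nehari level `c_I = inf_{N_K} I`. -/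
def cI (N : ℕ) (R₀ R₁ : ℝ) (a : EuclideanSpace ℝ (Fin N) → ℝ) (p : ℝ) : ℝ :=
  sInf {c | ∃ u, memNehari N R₀ R₁ a p u ∧ c = funcI N R₀ R₁ a p u}

/-- Test functions `C_c^∞(A)`. -/
def IsTestFun (N : ℕ) (R₀ R₁ : ℝ) (φ : EuclideanSpace ℝ (Fin N) → ℝ) : Prop :=
  ContDiff ℝ (⊤ : ℕ∞) φ ∧ HasCompactSupport φ ∧ tsupport φ ⊆ annulus N R₀ R₁

/-- Weak solution of `−Δu + u = a(x)|u|^{p−2}u` in `A`, `u = 0` on `∂A`. -/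
def IsWeakSolution (N : ℕ) (R₀ R₁ : ℝ) (a : EuclideanSpace ℝ (Fin N) → ℝ) (p : ℝ)
    (u : EuclideanSpace ℝ (Fin N) → ℝ) : Prop :=
  memC10 N R₀ R₁ u ∧
  ∀ φ : EuclideanSpace ℝ (Fin N) → ℝ, IsTestFun N R₀ R₁ φ →
    (∫ x in annulus N R₀ R₁,
      (fderivWithin ℝ u (closure (annulus N R₀ R₁)) x (gradient φ x) + u x * φ x))
    = ∫ x in annulus N R₀ R₁, a x * |u x| ^ (p - 2) * u x * φ x

/-- The (classical) Laplacian, as the sum of second partial derivatives. -/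
def lapl {N : ℕ} (u : EuclideanSpace ℝ (Fin N) → ℝ) (x : EuclideanSpace ℝ (Fin N)) : ℝ :=
  ∑ i : Fin N,
    fderiv ℝ (fun y => fderiv ℝ u y (EuclideanSpace.single i 1)) x (EuclideanSpace.single i 1)

/-- The inclusion `ℝ^{N-1} → ℝ^N`, `x' ↦ (x',0)`. -/
def embedHyper (N : ℕ) (x' : EuclideanSpace ℝ (Fin (N - 1))) : EuclideanSpace ℝ (Fin N) :=
  (WithLp.equiv 2 (Fin N → ℝ)).symm
    (fun j => if h : (j : ℕ) < N - 1 then x' ⟨j, h⟩ else 0)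

/-- A `C¹` distance on the closed annulus. -/
def C1dist (N : ℕ) (R₀ R₁ : ℝ) (u v : EuclideanSpace ℝ (Fin N) → ℝ) : ℝ :=
  (⨆ x : closure (annulus N R₀ R₁), |u x - v x|) +
  (⨆ x : closure (annulus N R₀ R₁),
    ‖fderivWithin ℝ u (closure (annulus N R₀ R₁)) x
      - fderivWithin ℝ v (closure (annulus N R₀ R₁)) x‖)

end



lemma lintegral_radial {E : Type*} [NormedAddCommGroup E] [NormedSpace ℝ E] [MeasurableSpace E]
    [Nontrivial E] (μ : Measure E) [FiniteDimensional ℝ E] [BorelSpace E] [μ.IsAddHaarMeasure]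
    (f : ℝ → ENNReal) (hf : Measurable f) :
    ∫⁻ x, f ‖x‖ ∂μ = (Module.finrank ℝ E * μ (Metric.ball 0 1)) *
      ∫⁻ y in Ioi (0:ℝ), ENNReal.ofReal (y ^ (Module.finrank ℝ E - 1)) * f y :=
  calc
    ∫⁻ x, f (‖x‖) ∂μ = ∫⁻ x : ({(0)}ᶜ : Set E), f (‖x.1‖) ∂(μ.comap (↑)) := by
      rw [lintegral_subtype_comap (measurableSet_singleton _).compl fun x ↦ f (‖x‖),
        restrict_compl_singleton]
    _ = ∫⁻ x, f x.2 ∂μ.toSphere.prod (.volumeIoiPow (Module.finrank ℝ E - 1)) := by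
      have := μ.measurePreserving_homeomorphUnitSphereProd.lintegral_comp_emb
        (Homeomorph.measurableEmbedding _) (f ∘ Subtype.val ∘ Prod.snd)
      simpa using this
    _ = μ.toSphere univ * ∫⁻ x : Ioi (0 : ℝ), f x ∂.volumeIoiPow (Module.finrank ℝ E - 1) := by
      rw [lintegral_prod _ (by fun_prop)]
      simp [mul_comm]
    _ = _ := by
      simp only [Measure.volumeIoiPow]
      rw [lintegral_withDensity_eq_lintegral_mul _ (by fun_prop) (by fun_prop), μ.toSphere_apply_univ]
      congr 1
      exact lintegral_subtype_comap measurableSet_Ioi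
        fun a ↦ ENNReal.ofReal (a ^ (Module.finrank ℝ E - 1)) * f a

lemma lintegral_cyl (n : ℕ) (hn : 1 ≤ n) (F : ℝ × ℝ → ENNReal) (hF : Measurable F) :
    ∃ c : ENNReal, c = n * volume (Metric.ball (0 : EuclideanSpace ℝ (Fin n)) 1) ∧
    ∫⁻ x : EuclideanSpace ℝ (Fin (n+1)), F (√(‖x‖^2 - x (Fin.last n) ^2), x (Fin.last n)) =
      c * ∫⁻ q : ℝ × ℝ, (Ioi (0:ℝ)).indicator (fun y => ENNReal.ofReal (y ^ (n-1))) q.1 * F q := by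
  refine ⟨_, rfl, ?_⟩
  have : Nonempty (Fin n) := ⟨⟨0, hn⟩⟩
  have h1 : ∫⁻ x : EuclideanSpace ℝ (Fin (n+1)), F (√(‖x‖^2 - x (Fin.last n) ^2), x (Fin.last n)) =
     ∫⁻ x : (Fin (n+1)) → ℝ, F (√(∑ i : Fin n, (x i.castSucc)^2), x (Fin.last n)) := by
    rw [← (PiLp.volume_preserving_ofLp (Fin (n+1))).lintegral_comp_emb
      (MeasurableEquiv.toLp 2 (Fin (n+1) → ℝ)).symm.measurableEmbedding]
    apply lintegral_congr
    intro x
    rw [EuclideanSpace.norm_sq_eq, Fin.sum_univ_castSucc]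
    simp
  have h2 : ∫⁻ x : (Fin (n+1)) → ℝ, F (√(∑ i : Fin n, (x i.castSucc)^2), x (Fin.last n)) =
     ∫⁻ q : ℝ × (Fin n → ℝ), F (√(∑ i : Fin n, (q.2 i)^2), q.1) := by
    rw [← (volume_preserving_piFinSuccAbove (fun _ : Fin (n+1) => ℝ) (Fin.last n)).lintegral_comp_emb
      (MeasurableEquiv.measurableEmbedding _)]
    apply lintegral_congr
    intro x
    simp [MeasurableEquiv.piFinSuccAbove_apply, Fin.init]
  have h3 : ∀ z : ℝ, ∫⁻ y : Fin n → ℝ, F (√(∑ i : Fin n, (y i)^2), z) =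
    ∫⁻ y : EuclideanSpace ℝ (Fin n), F (‖y‖, z) := by
    intro z
    rw [← (PiLp.volume_preserving_ofLp (Fin (n))).lintegral_comp_emb
      (MeasurableEquiv.toLp 2 (Fin (n) → ℝ)).symm.measurableEmbedding]
    apply lintegral_congr
    intro x
    rw [EuclideanSpace.norm_eq]
    simp
  rw [h1, h2, Measure.volume_eq_prod, lintegral_prod _ (by fun_prop)]
  simp_rw [h3]
  have h4 : ∀ z : ℝ, ∫⁻ y : EuclideanSpace ℝ (Fin n), F (‖y‖, z) =
      (n * volume (Metric.ball (0 : EuclideanSpace ℝ (Fin n)) 1)) *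
      ∫⁻ y in Ioi (0:ℝ), ENNReal.ofReal (y ^ (n - 1)) * F (y,z) := by
    intro z
    have := lintegral_radial (volume : Measure (EuclideanSpace ℝ (Fin n))) (fun r => F (r, z))
      (by fun_prop)
    simpa using this
  simp_rw [h4]
  have hm : Measurable (fun q : ℝ × ℝ => (Ioi (0:ℝ)).indicator (fun y => ENNReal.ofReal (y ^ (n-1))) q.1 * F q) := by
    refine Measurable.mul ?_ hF
    refine Measurable.comp (g := (Ioi (0:ℝ)).indicator (fun y => ENNReal.ofReal (y ^ (n-1)))) ?_ measurable_fst
    exact Measurable.indicator (by fun_prop) measurableSet_Ioi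
  rw [Measure.volume_eq_prod, lintegral_prod_symm _ hm.aemeasurable, ← lintegral_const_mul]
  · apply lintegral_congr
    intro z
    rw [← lintegral_indicator measurableSet_Ioi]
    congr 1
    apply lintegral_congr
    intro y
    by_cases hy : 0 < y <;> simp [hy]
  · exact hm.lintegral_prod_left'


lemma lastCoord_succ (n : ℕ) (x : EuclideanSpace ℝ (Fin (n+1))) : lastCoord x = x (Fin.last n) := by
  simp [lastCoord]; rfl

lemma lastCoord_sq_le (n : ℕ) (x : EuclideanSpace ℝ (Fin (n+1))) : x (Fin.last n) ^ 2 ≤ ‖x‖^2 := by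
  rw [EuclideanSpace.norm_sq_eq]
  have := Finset.single_le_sum (f := fun i => ‖x i‖^2) (fun i _ => by positivity) (Finset.mem_univ (Fin.last n))
  simpa using this

lemma measurableSet_annulus (N : ℕ) (R₀ R₁ : ℝ) : MeasurableSet (annulus N R₀ R₁) := by
  unfold annulus
  exact ((isOpen_lt continuous_const continuous_norm).inter (isOpen_lt continuous_norm continuous_const)).measurableSet

lemma sph_formula (n : ℕ) (hn : 1 ≤ n) (R₀ R₁ : ℝ) (hR₀ : 0 < R₀) (φ : ℝ × ℝ → ENNReal)
    (hφ : Measurable φ) :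
    ∫⁻ x in annulus (n+1) R₀ R₁, φ (‖x‖, angleOf x) =
      (n * volume (Metric.ball (0 : EuclideanSpace ℝ (Fin n)) 1)) *
       ∫⁻ q in Ioo R₀ R₁ ×ˢ Ioo (-(π/2)) (π/2),
        ENNReal.ofReal (q.1 * (q.1 * cos q.2)^(n-1)) * φ q := by
  set F : ℝ × ℝ → ENNReal := fun q =>
    (Ioo R₀ R₁).indicator (fun _ => φ (√(q.1^2+q.2^2), arcsin (q.2 / √(q.1^2+q.2^2)))) (√(q.1^2+q.2^2)) with hFdef
  have hF : Measurable F := by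
    have : F = ({q : ℝ × ℝ | √(q.1^2+q.2^2) ∈ Ioo R₀ R₁}).indicator
        (fun q => φ (√(q.1^2+q.2^2), arcsin (q.2 / √(q.1^2+q.2^2)))) := by
      funext q
      simp only [hFdef, indicator, mem_setOf_eq]
    rw [this]
    refine Measurable.indicator ?_ ?_
    · fun_prop
    · exact measurableSet_Ioo.preimage (by fun_prop)
  obtain ⟨c, hc, h⟩ := lintegral_cyl n hn F hF
  rw [← hc]
  have hL : ∫⁻ x in annulus (n+1) R₀ R₁, φ (‖x‖, angleOf x) =
      ∫⁻ x : EuclideanSpace ℝ (Fin (n+1)), F (√(‖x‖^2 - x (Fin.last n) ^2), x (Fin.last n)) := by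
    rw [← lintegral_indicator (measurableSet_annulus _ _ _)]
    apply lintegral_congr
    intro x
    have e : √(√(‖x‖^2 - x (Fin.last n) ^2)^2 + x (Fin.last n)^2) = ‖x‖ := by
      rw [sq_sqrt (by linarith [lastCoord_sq_le n x])]
      simp
    simp only [hFdef, e, indicator, annulus, angleOf, lastCoord_succ, mem_Ioo, mem_setOf_eq]
  rw [hL, h, ← lintegral_comp_polarCoord_symm]
  congr 1
  rw [← lintegral_indicator (polarCoord.open_target.measurableSet),
    ← lintegral_indicator (measurableSet_Ioo.prod measurableSet_Ioo)]
  apply lintegral_congr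
  rintro ⟨r, θ⟩
  simp only [indicator, polarCoord_target, polarCoord_symm_apply, mem_prod, mem_Ioo, mem_Ioi, hFdef]
  by_cases hr : 0 < r
  swap
  · rw [if_neg (by tauto), if_neg]
    rintro ⟨⟨h1, h2⟩, -⟩
    exact hr (hR₀.trans h1)
  have e : √((r * cos θ)^2 + (r * sin θ)^2) = r := by
    rw [show (r * cos θ)^2 + (r * sin θ)^2 = r^2 * (sin θ ^2 + cos θ^2) by ring]
    simp [hr.le]
  rw [e]
  have e2 : r * sin θ / r = sin θ := by field_simp
  rw [e2]
  by_cases hθ : -(π/2) < θ ∧ θ < π/2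
  · have hc : 0 < r * cos θ := mul_pos hr (cos_pos_of_mem_Ioo hθ)
    rw [if_pos (⟨hr, by constructor <;> linarith [hθ.1, hθ.2, pi_pos]⟩), if_pos hc]
    by_cases hr2 : R₀ < r ∧ r < R₁
    · rw [if_pos hr2, if_pos ⟨hr2, hθ⟩, arcsin_sin hθ.1.le hθ.2.le, ENNReal.ofReal_mul hr.le, smul_eq_mul, mul_assoc]
    · rw [if_neg hr2, if_neg (by tauto)]
      simp
  · rw [if_neg (c := (R₀ < r ∧ r < R₁) ∧ _) (by tauto)]
    by_cases hθ2 : -π < θ ∧ θ < π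
    · rw [if_pos ⟨hr, hθ2⟩, if_neg]
      · simp
      · rw [not_lt]
        apply mul_nonpos_of_nonneg_of_nonpos hr.le
        by_cases h1 : π/2 ≤ θ
        · exact cos_nonpos_of_pi_div_two_le_of_le h1 (by linarith [pi_pos])
        · rw [← cos_neg]
          apply cos_nonpos_of_pi_div_two_le_of_le
          · by_contra h2
            exact hθ ⟨by linarith, by linarith⟩
          · linarith [pi_pos]
    · rw [if_neg (by tauto)]


lemma plane_gag (a b : ℝ) (E : ℝ × ℝ → ENNReal) (hE : Measurable E) (W : ℝ → ℝ → ENNReal)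
    (h1 : ∀ r ∈ Ioo a b, ∀ θ ∈ Ioo (-(π/4)) (π/4), W r θ ≤ ∫⁻ s in Ioo a b, E (s, θ))
    (h2 : ∀ r ∈ Ioo a b, ∀ θ ∈ Ioo 0 (π/4), W r 0 ≤ W r θ + ∫⁻ t in Ioo (-(π/4)) (π/4), E (r, t))
    (h3 : ∀ r ∈ Ioo a b, ∀ θ ∈ Ioo (-(π/4)) (π/4), W r θ ≤ E (r, θ))
    (h4 : ∀ r ∈ Ioo a b, ∀ θ ∈ Ioo (-(π/2)) (π/2), W r θ ≤ W r 0)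
    (h5 : ∀ r ∈ Ioo a b, ∀ θ ∈ Ioo (-(π/2)) (π/2), π/4 ≤ |θ| → ∀ t ∈ Ioo 0 (π/4), W r θ ≤ W r t) :
    ∫⁻ q in Ioo a b ×ˢ Ioo (-(π/2)) (π/2), W q.1 q.2 ^ 2 ≤
      ENNReal.ofReal (5 * (1 + 4 / π)) *
        (∫⁻ q in Ioo a b ×ˢ Ioo (-(π/4)) (π/4), E q) ^ 2 := by
  have hpi := pi_pos
  set g : ℝ → ENNReal := fun θ => ∫⁻ s in Ioo a b, E (s, θ) with hg
  set H : ℝ → ENNReal := fun r => ∫⁻ t in Ioo (-(π/4)) (π/4), E (r, t) with hH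
  set J := ∫⁻ q in Ioo a b ×ˢ Ioo (-(π/4)) (π/4), E q with hJ
  have hgm : Measurable g := hE.lintegral_prod_left'
  have hHm : Measurable H := hE.lintegral_prod_right'
  have hJg : J = ∫⁻ θ in Ioo (-(π/4)) (π/4), g θ := by
    rw [hJ, Measure.volume_eq_prod, ← Measure.prod_restrict, lintegral_prod_symm _ hE.aemeasurable]
  have hJH : J = ∫⁻ r in Ioo a b, H r := by
    rw [hJ, Measure.volume_eq_prod, ← Measure.prod_restrict, lintegral_prod _ hE.aemeasurable]
  set l : ENNReal := ENNReal.ofReal (π/4) with hl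
  have hl0 : l ≠ 0 := by simp [hl, hpi]
  have hlt : l ≠ ⊤ := by simp [hl]
  have hH' : ∀ r ∈ Ioo a b, W r 0 ≤ (1 + l⁻¹) * H r := by
    intro r hr
    have : l * W r 0 ≤ H r + l * H r := by
      calc l * W r 0 = ∫⁻ θ in Ioo 0 (π/4), W r 0 := by
            simp [hl, mul_comm]
        _ ≤ ∫⁻ θ in Ioo 0 (π/4), (E (r, θ) + H r) := by
            apply setLIntegral_mono' measurableSet_Ioo
            intro θ hθ
            refine (h2 r hr θ hθ).trans ?_
            gcongr
            exact h3 r hr θ ⟨by linarith [hθ.1], hθ.2⟩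
        _ = (∫⁻ θ in Ioo 0 (π/4), E (r, θ)) + l * H r := by
            rw [lintegral_add_right _ measurable_const]
            simp [hl, mul_comm]
        _ ≤ _ := by
            gcongr
            exact lintegral_mono_set (Ioo_subset_Ioo_left (by linarith))
    calc W r 0 = l⁻¹ * (l * W r 0) := by
            rw [← mul_assoc, ENNReal.inv_mul_cancel hl0 hlt, one_mul]
      _ ≤ l⁻¹ * (H r + l * H r) := by gcongr
      _ = _ := by
            rw [mul_add, ← mul_assoc, ENNReal.inv_mul_cancel hl0 hlt]; ring
  set gh : ℝ → ENNReal := fun θ => (Ioo (-(π/4)) (π/4)).indicator g θ + l⁻¹ * J with hgh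
  have hghm : Measurable gh := (hgm.indicator measurableSet_Ioo).add_const _
  have hW : ∀ r ∈ Ioo a b, ∀ θ ∈ Ioo (-(π/2)) (π/2), W r θ ≤ gh θ := by
    intro r hr θ hθ
    by_cases hc : |θ| < π/4
    · have hθ' : θ ∈ Ioo (-(π/4)) (π/4) := abs_lt.mp hc
      simp only [hgh, indicator_of_mem hθ']
      exact (h1 r hr θ hθ').trans le_self_add
    · rw [not_lt] at hc
      have : l * W r θ ≤ J := by
        calc l * W r θ = ∫⁻ t in Ioo 0 (π/4), W r θ := by
                simp [hl, mul_comm]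
          _ ≤ ∫⁻ t in Ioo 0 (π/4), g t := by
            apply setLIntegral_mono' measurableSet_Ioo
            intro t ht
            exact (h5 r hr θ hθ hc t ht).trans (h1 r hr t ⟨by linarith [ht.1], ht.2⟩)
          _ ≤ J := by
            rw [hJg]
            exact lintegral_mono_set (Ioo_subset_Ioo_left (by linarith))
      calc W r θ = l⁻¹ * (l * W r θ) := by
            rw [← mul_assoc, ENNReal.inv_mul_cancel hl0 hlt, one_mul]
        _ ≤ l⁻¹ * J := by gcongr
        _ ≤ gh θ := le_add_self
  have hghi : ∫⁻ θ in Ioo (-(π/2)) (π/2), gh θ ≤ 5 * J := by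
    simp only [hgh]
    rw [lintegral_add_right _ measurable_const, setLIntegral_indicator measurableSet_Ioo, setLIntegral_const]
    have e : Ioo (-(π/4)) (π/4) ∩ Ioo (-(π/2)) (π/2) = Ioo (-(π/4)) (π/4) := by
      apply inter_eq_left.mpr
      exact Ioo_subset_Ioo (by linarith) (by linarith)
    rw [e, ← hJg, Real.volume_Ioo]
    have e2 : ENNReal.ofReal (π/2 - -(π/2)) = 4 * l := by
      rw [hl, show (4:ENNReal) = ENNReal.ofReal 4 by simp, ← ENNReal.ofReal_mul (by norm_num)]
      congr 1; ring
    rw [e2]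
    apply le_of_eq
    calc J + l⁻¹ * J * (4 * l) = J + 4 * J * (l⁻¹ * l) := by ring
      _ = 5 * J := by rw [ENNReal.inv_mul_cancel hl0 hlt]; ring
  calc ∫⁻ q in Ioo a b ×ˢ Ioo (-(π/2)) (π/2), W q.1 q.2 ^ 2
      ≤ ∫⁻ q in Ioo a b ×ˢ Ioo (-(π/2)) (π/2), ((1 + l⁻¹) * H q.1) * gh q.2 := by
        apply setLIntegral_mono' (measurableSet_Ioo.prod measurableSet_Ioo)
        rintro ⟨r, θ⟩ ⟨hr, hθ⟩
        simp only at hr hθ ⊢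
        rw [sq]
        exact mul_le_mul' ((h4 r hr θ hθ).trans (hH' r hr)) (hW r hr θ hθ)
    _ = (∫⁻ r in Ioo a b, (1 + l⁻¹) * H r) * ∫⁻ θ in Ioo (-(π/2)) (π/2), gh θ := by
        rw [Measure.volume_eq_prod, ← Measure.prod_restrict]
        rw [lintegral_prod_mul (f := fun r => (1 + l⁻¹) * H r) (by fun_prop) (by fun_prop)]
    _ ≤ ((1 + l⁻¹) * J) * (5 * J) := by
        rw [lintegral_const_mul _ hHm, ← hJH]
        gcongr
    _ = _ := by
        have : ENNReal.ofReal (5 * (1 + 4 / π)) = 5 * (1 + l⁻¹) := by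
          rw [ENNReal.ofReal_mul (by norm_num), ENNReal.ofReal_add (by norm_num) (by positivity), hl,
            ← ENNReal.ofReal_inv_of_pos (by positivity), inv_div]
          simp
        rw [this]; ring


section geom
variable {N : ℕ} {R₀ R₁ : ℝ}

lemma annulus_ball (hR₀ : 0 < R₀) (hR : R₀ < R₁) (x : EuclideanSpace ℝ (Fin N))
    (hx : R₀ ≤ ‖x‖ ∧ ‖x‖ ≤ R₁) :
    ∃ y, Metric.ball y ((R₁ - R₀)/2) ⊆ annulus N R₀ R₁ ∧ x ∈ Metric.closedBall y ((R₁-R₀)/2) := by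
  have hx0 : 0 < ‖x‖ := hR₀.trans_le hx.1
  refine ⟨((R₀+R₁)/2 / ‖x‖) • x, ?_, ?_⟩
  · have hn : ‖((R₀+R₁)/2 / ‖x‖) • x‖ = (R₀+R₁)/2 := by
      rw [norm_smul, Real.norm_of_nonneg (by have := hR₀.trans hR; positivity)]
      field_simp
    intro z hz
    rw [Metric.mem_ball, dist_eq_norm] at hz
    have h1 := abs_norm_sub_norm_le z (((R₀+R₁)/2 / ‖x‖) • x)
    rw [hn] at h1
    have h2 := abs_lt.mp (h1.trans_lt hz)
    exact ⟨by linarith [h2.1], by linarith [h2.2]⟩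
  · rw [Metric.mem_closedBall, dist_eq_norm]
    have : x - ((R₀+R₁)/2 / ‖x‖) • x = ((‖x‖ - (R₀+R₁)/2)/‖x‖) • x := by
      rw [sub_div, sub_smul, div_self hx0.ne', one_smul]
    rw [this, norm_smul, norm_div, norm_norm, div_mul_cancel₀ _ hx0.ne', Real.norm_eq_abs, abs_le]
    exact ⟨by linarith [hx.1], by linarith [hx.2]⟩

lemma closure_annulus (hR₀ : 0 < R₀) (hR : R₀ < R₁) :
    closure (annulus N R₀ R₁) = {x | R₀ ≤ ‖x‖ ∧ ‖x‖ ≤ R₁} := by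
  apply Subset.antisymm
  · apply closure_minimal
    · intro x hx
      exact ⟨hx.1.le, hx.2.le⟩
    · exact (isClosed_le continuous_const continuous_norm).inter (isClosed_le continuous_norm continuous_const)
  · intro x hx
    obtain ⟨y, hy, hxy⟩ := annulus_ball hR₀ hR x hx
    rw [← closure_ball y (by linarith)] at hxy
    exact closure_mono hy hxy

lemma isCompact_closure_annulus (hR₀ : 0 < R₀) (hR : R₀ < R₁) :
    IsCompact (closure (annulus N R₀ R₁)) := by
  refine (isCompact_closedBall (0 : EuclideanSpace ℝ (Fin N)) R₁).of_isClosed_subset isClosed_closure ?_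
  rw [closure_annulus hR₀ hR]
  intro x hx
  simpa using hx.2

lemma isOpen_annulus : IsOpen (annulus N R₀ R₁) :=
  (isOpen_lt continuous_const continuous_norm).inter (isOpen_lt continuous_norm continuous_const)

lemma uniqueDiffOn_annulus (hR₀ : 0 < R₀) (hR : R₀ < R₁) :
    UniqueDiffOn ℝ (closure (annulus N R₀ R₁)) := by
  intro x hx
  rw [closure_annulus hR₀ hR] at hx
  obtain ⟨y, hy, hxy⟩ := annulus_ball hR₀ hR x hx
  have h0 : (R₁-R₀)/2 ≠ 0 := by linarith
  refine UniqueDiffWithinAt.mono (s := Metric.closedBall y ((R₁-R₀)/2)) ?_ ?_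
  · refine uniqueDiffWithinAt_convex (convex_closedBall _ _) ?_ (subset_closure hxy)
    rw [interior_closedBall _ h0]
    exact ⟨y, by simp; linarith⟩
  · rw [← closure_ball y h0]
    exact closure_mono hy

end geom

noncomputable section
/-- point with polar coordinates `(r, θ)` in the half plane spanned by `ω` and the axis -/
def ptA {n : ℕ} (ω : EuclideanSpace ℝ (Fin (n+1))) (r θ : ℝ) : EuclideanSpace ℝ (Fin (n+1)) :=
  (r * cos θ) • ω + (r * sin θ) • EuclideanSpace.single (Fin.last n) (1:ℝ)
end

section pt
variable {n : ℕ} {ω : EuclideanSpace ℝ (Fin (n+1))}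

lemma ptA_last (h0 : ω (Fin.last n) = 0) (r θ : ℝ) : ptA ω r θ (Fin.last n) = r * sin θ := by
  simp [ptA, h0]

lemma norm_ptA (h1 : ‖ω‖ = 1) (h0 : ω (Fin.last n) = 0) (r θ : ℝ) : ‖ptA ω r θ‖ = |r| := by
  have : ‖ptA ω r θ‖^2 = r^2 := by
    rw [ptA, norm_add_sq_real, inner_smul_left, inner_smul_right, EuclideanSpace.inner_single_right,
      norm_smul, norm_smul, h0, h1]
    simp only [EuclideanSpace.norm_single, norm_one, mul_one, Real.norm_eq_abs, sq_abs]
    simp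
    linear_combination (r^2) * (sin_sq_add_cos_sq θ)
  rw [← abs_norm, ← sq_eq_sq_iff_abs_eq_abs, this]

lemma angleOf_ptA (h1 : ‖ω‖ = 1) (h0 : ω (Fin.last n) = 0) {r θ : ℝ} (hr : 0 < r)
    (hθ : θ ∈ Icc (-(π/2)) (π/2)) : angleOf (ptA ω r θ) = θ := by
  rw [angleOf, lastCoord_succ, ptA_last h0, norm_ptA h1 h0, abs_of_pos hr,
    mul_div_cancel_left₀ _ hr.ne', arcsin_sin hθ.1 hθ.2]

lemma exists_ptA (hn : 1 ≤ n) (x : EuclideanSpace ℝ (Fin (n+1))) (hx : x ≠ 0) :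
    ∃ ω : EuclideanSpace ℝ (Fin (n+1)), ‖ω‖ = 1 ∧ ω (Fin.last n) = 0 ∧ x = ptA ω ‖x‖ (angleOf x) := by
  have hx0 : 0 < ‖x‖ := norm_pos_iff.mpr hx
  set e : EuclideanSpace ℝ (Fin (n+1)) := EuclideanSpace.single (Fin.last n) (1:ℝ) with he
  set z := x (Fin.last n) with hz
  set y := x - z • e with hy
  have hylast : y (Fin.last n) = 0 := by simp [hy, he, hz]
  have hxy : x = y + z • e := by simp [hy]
  have hnorm : ‖x‖^2 = ‖y‖^2 + z^2 := by
    rw [hxy, norm_add_sq_real, inner_smul_right, he, EuclideanSpace.inner_single_right, hylast, norm_smul]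
    simp
  have hzl : |z / ‖x‖| ≤ 1 := by
    rw [abs_div, abs_norm, div_le_one hx0]
    exact abs_le_of_sq_le_sq (by nlinarith [sq_nonneg ‖y‖]) hx0.le
  have hsin : sin (angleOf x) = z / ‖x‖ := by
    rw [angleOf, lastCoord_succ, sin_arcsin (abs_le.mp hzl).1 (abs_le.mp hzl).2]
  have hcos : ‖x‖ * cos (angleOf x) = ‖y‖ := by
    rw [angleOf, lastCoord_succ, cos_arcsin]
    rw [← hz, show 1 - (z/‖x‖)^2 = (‖y‖/‖x‖)^2 by field_simp; linarith, sqrt_sq (by positivity)]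
    field_simp
  by_cases hy0 : y = 0
  · refine ⟨EuclideanSpace.single ⟨0, by omega⟩ 1, by simp, ?_, ?_⟩
    · rw [EuclideanSpace.single_apply, if_neg]
      intro h
      have := congrArg Fin.val h
      simp at this; omega
    · rw [ptA, hcos, hsin, hy0, mul_div_cancel₀ _ hx0.ne']
      simp only [norm_zero, zero_smul, zero_add]
      rw [← he]; nth_rewrite 1 [hxy]; simp [hy0]
  · have hyn : ‖y‖ ≠ 0 := by simpa using hy0
    refine ⟨‖y‖⁻¹ • y, ?_, ?_, ?_⟩
    · rw [norm_smul]; simp [hyn]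
    · simp [hylast]
    · rw [ptA, hcos, hsin, mul_div_cancel₀ _ hx0.ne', smul_smul, mul_inv_cancel₀ hyn, one_smul]
      exact hxy

lemma hasDerivAt_ptA_r (r θ : ℝ) : HasDerivAt (fun s => ptA ω s θ) (ptA ω 1 θ) r := by
  unfold ptA
  exact (((hasDerivAt_id r).mul_const (cos θ)).smul_const ω).add
    (((hasDerivAt_id r).mul_const (sin θ)).smul_const _)

lemma hasDerivAt_ptA_t (r θ : ℝ) : HasDerivAt (fun t => ptA ω r t) (ptA ω r (θ + π/2)) θ := by
  unfold ptA
  rw [cos_add_pi_div_two, sin_add_pi_div_two]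
  exact (((hasDerivAt_cos θ).const_mul r).smul_const ω).add
    (((hasDerivAt_sin θ).const_mul r).smul_const _)

lemma continuous_ptA : Continuous (fun q : ℝ × ℝ => ptA ω q.1 q.2) := by
  unfold ptA; fun_prop

end pt


lemma ftc_le {a b : ℝ} (hab : a ≤ b) {f f' φ : ℝ → ℝ} (hf : ContinuousOn f (Icc a b))
    (hd : ∀ x ∈ Ioo a b, HasDerivAt f (f' x) x) (hφ : ContinuousOn φ (Icc a b))
    (hφ0 : ∀ x ∈ Icc a b, 0 ≤ φ x)
    (hle : ∀ x ∈ Ioo a b, f' x ≤ φ x) :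
    ENNReal.ofReal (f b - f a) ≤ ∫⁻ x in Ioo a b, ENNReal.ofReal (φ x) := by
  have hIcc_int : IntegrableOn φ (Icc a b) := hφ.integrableOn_Icc
  have h := intervalIntegral.sub_le_integral_of_hasDeriv_right_of_le hab hf
    (fun x hx => (hd x hx).hasDerivWithinAt) hIcc_int hle
  rw [intervalIntegral.integral_of_le hab, integral_Ioc_eq_integral_Ioo] at h
  rw [← ofReal_integral_eq_lintegral_ofReal (hIcc_int.mono_set Ioo_subset_Icc_self)]
  · exact ENNReal.ofReal_le_ofReal h
  · filter_upwards [ae_restrict_mem measurableSet_Ioo] with x hx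
    exact hφ0 x (Ioo_subset_Icc_self hx)

section
variable {n : ℕ} {R₀ R₁ : ℝ} {u : EuclideanSpace ℝ (Fin (n+1)) → ℝ}
  {ω : EuclideanSpace ℝ (Fin (n+1))}

lemma ptA_mem (hR₀ : 0 < R₀) (hR : R₀ < R₁) (h1 : ‖ω‖ = 1) (h0 : ω (Fin.last n) = 0)
    {r : ℝ} (hr : r ∈ Icc R₀ R₁) (θ : ℝ) : ptA ω r θ ∈ closure (annulus (n+1) R₀ R₁) := by
  rw [closure_annulus hR₀ hR]
  change R₀ ≤ ‖ptA ω r θ‖ ∧ ‖ptA ω r θ‖ ≤ R₁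
  rw [norm_ptA h1 h0, abs_of_pos (hR₀.trans_le hr.1)]
  exact hr

lemma deriv_r (hR₀ : 0 < R₀) (hR : R₀ < R₁) (h1 : ‖ω‖ = 1) (h0 : ω (Fin.last n) = 0)
    (hu : ContDiffOn ℝ 1 u (closure (annulus (n+1) R₀ R₁)))
    {r : ℝ} (hr : r ∈ Icc R₀ R₁) (θ : ℝ) :
    HasDerivWithinAt (fun s => u (ptA ω s θ))
      (fderivWithin ℝ u (closure (annulus (n+1) R₀ R₁)) (ptA ω r θ) (ptA ω 1 θ)) (Icc R₀ R₁) r := by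
  have hm := ptA_mem hR₀ hR h1 h0 hr θ
  have hf := ((hu.differentiableOn (by norm_num)) _ hm).hasFDerivWithinAt
  exact hf.comp_hasDerivWithinAt r (hasDerivAt_ptA_r r θ).hasDerivWithinAt
    (fun s hs => ptA_mem hR₀ hR h1 h0 hs θ)

lemma deriv_t (hR₀ : 0 < R₀) (hR : R₀ < R₁) (h1 : ‖ω‖ = 1) (h0 : ω (Fin.last n) = 0)
    (hu : ContDiffOn ℝ 1 u (closure (annulus (n+1) R₀ R₁)))
    {r : ℝ} (hr : r ∈ Icc R₀ R₁) (θ : ℝ) :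
    HasDerivAt (fun t => u (ptA ω r t))
      (fderivWithin ℝ u (closure (annulus (n+1) R₀ R₁)) (ptA ω r θ) (ptA ω r (θ + π/2))) θ := by
  have hm := ptA_mem hR₀ hR h1 h0 hr θ
  have hf := ((hu.differentiableOn (by norm_num)) _ hm).hasFDerivWithinAt
  rw [← hasDerivWithinAt_univ]
  exact hf.comp_hasDerivWithinAt θ (hasDerivAt_ptA_t r θ).hasDerivWithinAt
    (fun s _ => ptA_mem hR₀ hR h1 h0 hr s)

/-- the derivative data along the half plane `ω` do not depend on `ω` -/
lemma deriv_bounds (hR₀ : 0 < R₀) (hR : R₀ < R₁) (h1 : ‖ω‖ = 1) (h0 : ω (Fin.last n) = 0)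
    (hn : 1 ≤ n)
    (hu : ContDiffOn ℝ 1 u (closure (annulus (n+1) R₀ R₁))) (U : ℝ → ℝ → ℝ)
    (hU : IsAxiallySymmRep (n+1) R₀ R₁ u U) (x : EuclideanSpace ℝ (Fin (n+1)))
    (hx : x ∈ closure (annulus (n+1) R₀ R₁)) :
    u x = u (ptA ω ‖x‖ (angleOf x)) ∧
    |fderivWithin ℝ u (closure (annulus (n+1) R₀ R₁)) (ptA ω ‖x‖ (angleOf x)) (ptA ω 1 (angleOf x))|
      ≤ ‖fderivWithin ℝ u (closure (annulus (n+1) R₀ R₁)) x‖ ∧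
    |fderivWithin ℝ u (closure (annulus (n+1) R₀ R₁)) (ptA ω ‖x‖ (angleOf x))
      (ptA ω ‖x‖ (angleOf x + π/2))|
      ≤ R₁ * ‖fderivWithin ℝ u (closure (annulus (n+1) R₀ R₁)) x‖ := by
  have hx' : ‖x‖ ∈ Icc R₀ R₁ := by
    rw [closure_annulus hR₀ hR] at hx; exact hx
  have hxpos : 0 < ‖x‖ := hR₀.trans_le hx'.1
  obtain ⟨w, w1, w0, hw⟩ := exists_ptA hn x (norm_pos_iff.mp hxpos)
  have hang : angleOf x ∈ Icc (-(π/2)) (π/2) := by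
    unfold angleOf; exact arcsin_mem_Icc _
  have key : ∀ r ∈ Icc R₀ R₁, ∀ θ ∈ Icc (-(π/2)) (π/2), u (ptA w r θ) = u (ptA ω r θ) := by
    intro r hr θ hθ
    have hr0 : 0 < r := hR₀.trans_le hr.1
    rw [hU _ (ptA_mem hR₀ hR h1 h0 hr θ), hU _ (ptA_mem hR₀ hR w1 w0 hr θ), norm_ptA h1 h0,
      norm_ptA w1 w0, angleOf_ptA h1 h0 hr0 hθ, angleOf_ptA w1 w0 hr0 hθ]
  set L := fderivWithin ℝ u (closure (annulus (n+1) R₀ R₁)) with hL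
  refine ⟨?_, ?_, ?_⟩
  · conv_lhs => rw [hw]
    exact key _ hx' _ hang
  · have d1 := deriv_r hR₀ hR h1 h0 hu hx' (angleOf x)
    have d2 := deriv_r hR₀ hR w1 w0 hu hx' (angleOf x)
    have d3 := d2.congr (f₁ := fun s => u (ptA ω s (angleOf x))) (fun s hs => (key s hs _ hang).symm)
      ((key _ hx' _ hang).symm)
    have e := ((uniqueDiffOn_Icc hR) _ hx').eq_deriv _ d1 d3
    rw [← hL] at e
    rw [e, ← hw]
    have := (L x).le_opNorm (ptA w 1 (angleOf x))
    rw [norm_ptA w1 w0] at this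
    simpa using this
  · have d1 := (deriv_t hR₀ hR h1 h0 hu hx' (angleOf x)).hasDerivWithinAt (s := Icc (-(π/2)) (π/2))
    have d2 := (deriv_t hR₀ hR w1 w0 hu hx' (angleOf x)).hasDerivWithinAt (s := Icc (-(π/2)) (π/2))
    have d3 := d2.congr (f₁ := fun s => u (ptA ω ‖x‖ s)) (fun s hs => (key _ hx' s hs).symm)
      ((key _ hx' _ hang).symm)
    have e := ((uniqueDiffOn_Icc (by linarith [pi_pos])) _ hang).eq_deriv _ d1 d3
    rw [← hL] at e
    rw [e, ← hw]
    have := (L x).le_opNorm (ptA w ‖x‖ (angleOf x + π/2))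
    rw [norm_ptA w1 w0, abs_norm] at this
    calc _ ≤ ‖L x‖ * ‖x‖ := by simpa using this
      _ ≤ R₁ * ‖L x‖ := by
        rw [mul_comm]; gcongr; exact hx'.2
end


lemma key_ineq (n : ℕ) (hn : 1 ≤ n) (R₀ R₁ : ℝ) (hR₀ : 0 < R₀) (hR : R₀ < R₁) :
    ∃ C : ENNReal, C ≠ ⊤ ∧ ∀ u, memK (n+1) R₀ R₁ u → ∀ k : ℕ,
      ∫⁻ x in annulus (n+1) R₀ R₁, ENNReal.ofReal (u x ^ (k+1)) ^ 2 ≤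
        C * (∫⁻ x in annulus (n+1) R₀ R₁, ENNReal.ofReal ((k+1) * u x ^ k *
          (u x + ‖fderivWithin ℝ u (closure (annulus (n+1) R₀ R₁)) x‖))) ^ 2 := by
  have hpi := pi_pos
  have hR₁ : 0 < R₁ := hR₀.trans hR
  set c : ENNReal := n * volume (Metric.ball (0 : EuclideanSpace ℝ (Fin n)) 1) with hc
  have hctop : c ≠ ⊤ := ENNReal.mul_ne_top (by simp) measure_ball_lt_top.ne
  have hc0 : c ≠ 0 := by
    refine mul_ne_zero (by simp; omega) (Metric.measure_ball_pos _ _ one_pos).ne'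
  have hcos : 0 < cos (π/4) := by rw [cos_pi_div_four]; positivity
  set w0 : ENNReal := ENNReal.ofReal (R₀ * (R₀ * cos (π/4))^(n-1)) with hw0
  have hw00 : w0 ≠ 0 := by simp only [hw0, ne_eq, ENNReal.ofReal_eq_zero, not_le]; positivity
  have hw0t : w0 ≠ ⊤ := by simp [hw0]
  set w1 : ENNReal := ENNReal.ofReal (R₁ * R₁^(n-1)) with hw1
  set m : ENNReal := ENNReal.ofReal (1 + R₁) with hm
  refine ⟨c * w1 * ENNReal.ofReal (5 * (1 + 4 / π)) * ((c * w0)⁻¹ * m)^2, ?_, ?_⟩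
  · refine ENNReal.mul_ne_top (ENNReal.mul_ne_top (ENNReal.mul_ne_top hctop (by simp [hw1])) ENNReal.ofReal_ne_top) ?_
    refine ENNReal.pow_ne_top (ENNReal.mul_ne_top ?_ (by simp [hm]))
    exact ENNReal.inv_ne_top.mpr (mul_ne_zero hc0 hw00)
  rintro u ⟨⟨hu, hu0, U, hU, hUeven, hUanti⟩, hubd⟩ k
  -- a fixed half plane
  obtain ⟨ω, h1, h0⟩ : ∃ ω : EuclideanSpace ℝ (Fin (n+1)), ‖ω‖ = 1 ∧ ω (Fin.last n) = 0 := by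
    refine ⟨EuclideanSpace.single ⟨0, by omega⟩ 1, by simp, ?_⟩
    rw [PiLp.single_apply, if_neg]
    intro h
    have := congrArg Fin.val h
    simp at this; omega
  set S := closure (annulus (n+1) R₀ R₁) with hS
  set L := fderivWithin ℝ u S with hL
  have hLc : ContinuousOn L S := hu.continuousOn_fderivWithin (uniqueDiffOn_annulus hR₀ hR) (by norm_num)
  set cl : ℝ → ℝ := fun r => max R₀ (min r R₁) with hcl
  have hclc : Continuous cl := by fun_prop
  have hclm : ∀ r, cl r ∈ Icc R₀ R₁ := fun r => ⟨le_max_left _ _, max_le hR.le (min_le_right _ _)⟩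
  have hcle : ∀ r ∈ Icc R₀ R₁, cl r = r := by
    intro r hr
    simp only [hcl, min_eq_left hr.2, max_eq_right hr.1]
  have hpm : ∀ r θ, ptA ω (cl r) θ ∈ S := fun r θ => ptA_mem hR₀ hR h1 h0 (hclm r) θ
  have hpc : Continuous (fun q : ℝ × ℝ => ptA ω (cl q.1) q.2) :=
    continuous_ptA.comp (f := fun q : ℝ × ℝ => (cl q.1, q.2)) (by fun_prop)
  set V : ℝ → ℝ → ℝ := fun r θ => u (ptA ω (cl r) θ) with hV
  have hV0 : ∀ r θ, 0 ≤ V r θ := fun r θ => hu0 _ (hpm r θ)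
  have hVc : Continuous (fun q : ℝ × ℝ => V q.1 q.2) :=
    hu.continuousOn.comp_continuous hpc (fun q => hpm _ _)
  set e : ℝ → ℝ → ℝ := fun r θ => (k+1) * V r θ ^ k * (V r θ + (|L (ptA ω (cl r) θ) (ptA ω 1 θ)| +
    |L (ptA ω (cl r) θ) (ptA ω (cl r) (θ + π/2))|)) with he
  have hec : Continuous (fun q : ℝ × ℝ => e q.1 q.2) := by
    have hL1 : Continuous (fun q : ℝ × ℝ => L (ptA ω (cl q.1) q.2)) :=
      hLc.comp_continuous hpc (fun q => hpm _ _)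
    have hp1 : Continuous (fun q : ℝ × ℝ => ptA ω 1 q.2) :=
      continuous_ptA.comp (f := fun q : ℝ × ℝ => ((1:ℝ), q.2)) (by fun_prop)
    have hp2 : Continuous (fun q : ℝ × ℝ => ptA ω (cl q.1) (q.2 + π/2)) :=
      continuous_ptA.comp (f := fun q : ℝ × ℝ => (cl q.1, q.2 + π/2)) (by fun_prop)
    have a1 := (hL1.clm_apply hp1).abs
    have a2 := (hL1.clm_apply hp2).abs
    exact ((continuous_const.mul (hVc.pow k))).mul (hVc.add (a1.add a2))
  have he0 : ∀ r θ, 0 ≤ e r θ := by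
    intro r θ
    have := hV0 r θ
    simp only [he]; positivity
  have hVU : ∀ r ∈ Icc R₀ R₁, ∀ θ ∈ Icc (-(π/2)) (π/2), V r θ = U r θ := by
    intro r hr θ hθ
    have hr0 : 0 < r := hR₀.trans_le hr.1
    simp only [hV]
    rw [hU _ (hpm r θ), hcle r hr, norm_ptA h1 h0, angleOf_ptA h1 h0 hr0 hθ, abs_of_pos hr0]
  have hVdec : ∀ r ∈ Icc R₀ R₁, ∀ θ ∈ Icc (-(π/2)) (π/2), ∀ t, 0 ≤ t → t ≤ |θ| → V r θ ≤ V r t := by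
    intro r hr θ hθ t ht htθ
    have habs : |θ| ≤ π/2 := abs_le.mpr hθ
    have hθ' : |θ| ∈ Icc (-(π/2)) (π/2) := ⟨by linarith [abs_nonneg θ], habs⟩
    have hθe : V r θ = V r |θ| := by
      rw [hVU r hr θ hθ, hVU r hr _ hθ']
      rcases abs_choice θ with h | h <;> rw [h]
      rw [hUeven r hr θ hθ]
    rw [hθe, hVU r hr _ hθ', hVU r hr t ⟨by linarith, by linarith⟩]
    exact hUanti r hr ⟨ht, by linarith⟩ ⟨abs_nonneg _, habs⟩ htθ
  -- FTC hypotheses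
  have hgag := plane_gag R₀ R₁ (fun q => ENNReal.ofReal (e q.1 q.2))
    (ENNReal.measurable_ofReal.comp hec.measurable) (fun r θ => ENNReal.ofReal (V r θ ^ (k+1)))
    ?_ ?_ ?_ ?_ ?_
  rotate_left
  · -- radial
    intro r hr θ hθ
    have hzero : V R₀ θ = 0 := by
      simp only [hV]
      apply hubd
      left
      rw [norm_ptA h1 h0, hcle R₀ (left_mem_Icc.mpr hR.le), abs_of_pos hR₀]
    have := ftc_le (a := R₀) (b := r) hr.1.le (f := fun s => V s θ ^ (k+1))
      (f' := fun s => (k+1) * V s θ ^ k * L (ptA ω s θ) (ptA ω 1 θ)) (φ := fun s => e s θ)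
      (by
        have : Continuous (fun s => V s θ ^ (k+1)) :=
          (hVc.comp (f := fun s : ℝ => (s, θ)) (by fun_prop)).pow _
        exact this.continuousOn)
      (by
        intro s hs
        have hsI : s ∈ Ioo R₀ R₁ := ⟨hs.1, hs.2.trans hr.2⟩
        have d := (deriv_r hR₀ hR h1 h0 hu (Ioo_subset_Icc_self hsI) θ).hasDerivAt (Icc_mem_nhds hsI.1 hsI.2)
        have d' : HasDerivAt (fun s => V s θ) (L (ptA ω s θ) (ptA ω 1 θ)) s := by
          refine d.congr_of_eventuallyEq ?_
          filter_upwards [Icc_mem_nhds hsI.1 hsI.2] with y hy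
          simp only [hV, hcle y hy]
        have := d'.fun_pow (k+1)
        simpa using this)
      (by
        have : Continuous (fun s => e s θ) := hec.comp (f := fun s : ℝ => (s, θ)) (by fun_prop)
        exact this.continuousOn)
      (fun s _ => he0 s θ)
      (by
        intro s hs
        have hsI : s ∈ Icc R₀ R₁ := ⟨hs.1.le, (hs.2.trans hr.2).le⟩
        have hv := hV0 s θ
        simp only [he, hcle s hsI]
        apply mul_le_mul_of_nonneg_left _ (by positivity)
        have := le_abs_self (L (ptA ω s θ) (ptA ω 1 θ))
        have := abs_nonneg (L (ptA ω s θ) (ptA ω s (θ + π/2)))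
        linarith)
    simp only [hzero] at this
    rw [zero_pow (by omega), sub_zero] at this
    exact this.trans (lintegral_mono_set (Ioo_subset_Ioo_right hr.2.le))
  · -- angular
    intro r hr θ hθ
    have hrI : r ∈ Icc R₀ R₁ := Ioo_subset_Icc_self hr
    have := ftc_le (a := 0) (b := θ) hθ.1.le (f := fun t => -(V r t ^ (k+1)))
      (f' := fun t => -((k+1) * V r t ^ k * L (ptA ω r t) (ptA ω r (t + π/2)))) (φ := fun t => e r t)
      (by
        have : Continuous (fun t => -(V r t ^ (k+1))) :=
          ((hVc.comp (f := fun t : ℝ => (r, t)) (by fun_prop)).pow _).neg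
        exact this.continuousOn)
      (by
        intro s hs
        have d := (deriv_t hR₀ hR h1 h0 hu hrI s)
        have d' : HasDerivAt (fun s => V r s) (L (ptA ω r s) (ptA ω r (s + π/2))) s := by
          simp only [hV, hcle r hrI]
          exact d
        have := (d'.fun_pow (k+1)).fun_neg
        simpa using this)
      (by
        have : Continuous (fun t => e r t) := hec.comp (f := fun t : ℝ => (r, t)) (by fun_prop)
        exact this.continuousOn)
      (fun s _ => he0 r s)
      (by
        intro s hs
        have hv := hV0 r s
        simp only [he, hcle r hrI]
        rw [← mul_neg]
        apply mul_le_mul_of_nonneg_left _ (by positivity)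
        have := neg_le_abs (L (ptA ω r s) (ptA ω r (s + π/2)))
        have := abs_nonneg (L (ptA ω r s) (ptA ω 1 s))
        linarith)
    have h3 : ENNReal.ofReal (V r 0 ^ (k+1)) ≤ ENNReal.ofReal (V r θ ^ (k+1)) +
        ENNReal.ofReal (-(V r θ ^ (k+1)) - -(V r 0 ^ (k+1))) := by
      refine le_trans (ENNReal.ofReal_le_ofReal ?_) ENNReal.ofReal_add_le
      linarith
    refine h3.trans ?_
    gcongr
    exact this.trans (lintegral_mono_set (Ioo_subset_Ioo (by linarith) hθ.2.le))
  · intro r hr θ hθ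
    apply ENNReal.ofReal_le_ofReal
    have hv := hV0 r θ
    simp only [he]
    calc V r θ ^ (k+1) = 1 * V r θ ^ k * V r θ := by ring
      _ ≤ _ := by
        gcongr
        · simp
        · have := abs_nonneg (L (ptA ω (cl r) θ) (ptA ω 1 θ))
          have := abs_nonneg (L (ptA ω (cl r) θ) (ptA ω (cl r) (θ + π/2)))
          linarith
  · intro r hr θ hθ
    apply ENNReal.ofReal_le_ofReal
    exact pow_le_pow_left₀ (hV0 _ _) (hVdec r (Ioo_subset_Icc_self hr) θ (Ioo_subset_Icc_self hθ) 0 le_rfl (abs_nonneg _)) _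
  · intro r hr θ hθ hθ2 t ht
    apply ENNReal.ofReal_le_ofReal
    exact pow_le_pow_left₀ (hV0 _ _) (hVdec r (Ioo_subset_Icc_self hr) θ (Ioo_subset_Icc_self hθ) t ht.1.le
      (ht.2.le.trans hθ2)) _
  set J := ∫⁻ q in Ioo R₀ R₁ ×ˢ Ioo (-(π/4)) (π/4), ENNReal.ofReal (e q.1 q.2) with hJ
  set T := (∫⁻ x in annulus (n+1) R₀ R₁, ENNReal.ofReal ((k+1) * u x ^ k * (u x + ‖L x‖))) with hT
  have hup : ∫⁻ x in annulus (n+1) R₀ R₁, ENNReal.ofReal (u x ^ (k+1)) ^ 2 ≤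
      c * (w1 * ∫⁻ q in Ioo R₀ R₁ ×ˢ Ioo (-(π/2)) (π/2), ENNReal.ofReal (V q.1 q.2 ^ (k+1)) ^ 2) := by
    have hmeas : Measurable (fun q : ℝ × ℝ => ENNReal.ofReal (V q.1 q.2 ^ (k+1)) ^ 2) :=
      (ENNReal.measurable_ofReal.comp (hVc.pow _).measurable).pow_const _
    have e1 : ∫⁻ x in annulus (n+1) R₀ R₁, ENNReal.ofReal (u x ^ (k+1)) ^ 2 =
        ∫⁻ x in annulus (n+1) R₀ R₁, (fun q : ℝ × ℝ => ENNReal.ofReal (V q.1 q.2 ^ (k+1)) ^ 2) (‖x‖, angleOf x) := by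
      apply setLIntegral_congr_fun (measurableSet_annulus _ _ _)
      intro x hx
      have hxS : x ∈ S := subset_closure hx
      have := (deriv_bounds hR₀ hR h1 h0 hn hu U hU x hxS).1
      simp only [hV]
      rw [hcle ‖x‖ ⟨hx.1.le, hx.2.le⟩, ← this]
    rw [e1, sph_formula n hn R₀ R₁ hR₀ _ hmeas, ← lintegral_const_mul _ hmeas]
    refine mul_le_mul' le_rfl ?_
    apply setLIntegral_mono' (measurableSet_Ioo.prod measurableSet_Ioo)
    rintro ⟨r, θ⟩ ⟨hr, hθ⟩
    refine mul_le_mul' ?_ le_rfl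
    simp only [mem_Ioo] at hr hθ
    have hr0 : 0 < r := hR₀.trans hr.1
    apply ENNReal.ofReal_le_ofReal
    have hcθ : 0 < cos θ := cos_pos_of_mem_Ioo hθ
    have := cos_le_one θ
    change r * (r * cos θ)^(n-1) ≤ _
    have h3 : r * cos θ ≤ R₁ := by nlinarith
    gcongr
    exact hr.2.le
  have hlow : c * (w0 * J) ≤ m * T := by
    have hmeas : Measurable (fun q : ℝ × ℝ => ENNReal.ofReal (e q.1 q.2)) :=
      (ENNReal.measurable_ofReal.comp hec.measurable)
    have e2 : ∫⁻ x in annulus (n+1) R₀ R₁, (fun q : ℝ × ℝ => ENNReal.ofReal (e q.1 q.2)) (‖x‖, angleOf x) ≤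
        m * T := by
      rw [hT, ← lintegral_const_mul' _ _ (by simp [hm])]
      apply setLIntegral_mono' (measurableSet_annulus _ _ _)
      intro x hx
      have hxS : x ∈ S := subset_closure hx
      obtain ⟨b1, b2, b3⟩ := deriv_bounds hR₀ hR h1 h0 hn hu U hU x hxS
      have hux := hu0 x hxS
      simp only [hm]
      rw [← ENNReal.ofReal_mul (by linarith)]
      apply ENNReal.ofReal_le_ofReal
      simp only [he, hV]
      rw [hcle ‖x‖ ⟨hx.1.le, hx.2.le⟩, ← b1]
      rw [show (1 + R₁) * ((k+1) * u x ^ k * (u x + ‖L x‖)) = (k+1) * u x ^ k * ((1 + R₁) * (u x + ‖L x‖)) by ring]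
      apply mul_le_mul_of_nonneg_left _ (by positivity)
      have : 0 ≤ R₁ * u x := by positivity
      nlinarith
    refine le_trans ?_ e2
    rw [sph_formula n hn R₀ R₁ hR₀ _ hmeas, hJ, ← lintegral_const_mul _ hmeas]
    refine mul_le_mul' le_rfl ?_
    refine le_trans ?_ (lintegral_mono_set (s := Ioo R₀ R₁ ×ˢ Ioo (-(π/4)) (π/4)) ?_)
    · apply setLIntegral_mono' (measurableSet_Ioo.prod measurableSet_Ioo)
      rintro ⟨r, θ⟩ ⟨hr, hθ⟩
      refine mul_le_mul' ?_ le_rfl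
      simp only [mem_Ioo] at hr hθ
      apply ENNReal.ofReal_le_ofReal
      change _ ≤ r * (r * cos θ)^(n-1)
      have hcθ : cos (π/4) ≤ cos θ := by
        rw [← cos_abs θ]
        exact cos_le_cos_of_nonneg_of_le_pi (abs_nonneg _) (by linarith) (abs_le.mpr ⟨hθ.1.le, hθ.2.le⟩)
      have := hr.1.le
      have hr0 : 0 < r := hR₀.trans hr.1
      gcongr
    · exact prod_mono le_rfl (Ioo_subset_Ioo (by linarith) (by linarith))
  have hJT : J ≤ (c * w0)⁻¹ * m * T := by
    calc J = (c * w0)⁻¹ * (c * w0) * J := by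
            rw [ENNReal.inv_mul_cancel (mul_ne_zero hc0 hw00) (ENNReal.mul_ne_top hctop hw0t), one_mul]
      _ = (c * w0)⁻¹ * (c * (w0 * J)) := by ring
      _ ≤ (c * w0)⁻¹ * (m * T) := by gcongr
      _ = _ := by ring
  calc _ ≤ _ := hup
    _ ≤ c * (w1 * (ENNReal.ofReal (5 * (1 + 4 / π)) * J ^ 2)) := by gcongr
    _ ≤ c * (w1 * (ENNReal.ofReal (5 * (1 + 4 / π)) * ((c * w0)⁻¹ * m * T) ^ 2)) := by gcongr
    _ = _ := by ring


lemma annulus_sub (N : ℕ) (R₀ R₁ : ℝ) : annulus N R₀ R₁ ⊆ closure (annulus N R₀ R₁) := subset_closure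

lemma intOn_annulus {N : ℕ} {R₀ R₁ : ℝ} (hR₀ : 0 < R₀) (hR : R₀ < R₁)
    {f : EuclideanSpace ℝ (Fin N) → ℝ} (hf : ContinuousOn f (closure (annulus N R₀ R₁))) :
    IntegrableOn f (annulus N R₀ R₁) :=
  (hf.integrableOn_compact (isCompact_closure_annulus hR₀ hR)).mono_set subset_closure

lemma cont_fdw {N : ℕ} {R₀ R₁ : ℝ} (hR₀ : 0 < R₀) (hR : R₀ < R₁)
    {u : EuclideanSpace ℝ (Fin N) → ℝ} (hu : ContDiffOn ℝ 1 u (closure (annulus N R₀ R₁))) :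
    ContinuousOn (fderivWithin ℝ u (closure (annulus N R₀ R₁))) (closure (annulus N R₀ R₁)) :=
  hu.continuousOn_fderivWithin (uniqueDiffOn_annulus hR₀ hR) le_rfl

lemma H1sq_nonneg (N : ℕ) (R₀ R₁ : ℝ) (u : EuclideanSpace ℝ (Fin N) → ℝ) : 0 ≤ H1sq N R₀ R₁ u :=
  integral_nonneg fun _ => by positivity

lemma H1sq_lint {N : ℕ} {R₀ R₁ : ℝ} (hR₀ : 0 < R₀) (hR : R₀ < R₁)
    {u : EuclideanSpace ℝ (Fin N) → ℝ} (hu : ContDiffOn ℝ 1 u (closure (annulus N R₀ R₁))) :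
    ∫⁻ x in annulus N R₀ R₁, ENNReal.ofReal
      (‖fderivWithin ℝ u (closure (annulus N R₀ R₁)) x‖ ^ 2 + (u x) ^ 2)
      = ENNReal.ofReal (H1sq N R₀ R₁ u) := by
  unfold H1sq
  rw [ofReal_integral_eq_lintegral_ofReal]
  · exact intOn_annulus hR₀ hR (((cont_fdw hR₀ hR hu).norm.pow 2).add (hu.continuousOn.pow 2))
  · exact Filter.Eventually.of_forall fun _ => by positivity

lemma cs_lint {X : Type*} [MeasurableSpace X] (μ : Measure X) (f g : X → ENNReal)
    (hf : AEMeasurable f μ) (hg : AEMeasurable g μ) :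
    (∫⁻ x, f x * g x ∂μ)^2 ≤ (∫⁻ x, f x ^ 2 ∂μ) * (∫⁻ x, g x ^ 2 ∂μ) := by
  have h := ENNReal.lintegral_mul_le_Lp_mul_Lq μ Real.HolderConjugate.two_two hf hg
  simp only [Pi.mul_apply, ENNReal.rpow_two] at h
  refine (pow_le_pow_left' h 2).trans_eq ?_
  rw [mul_pow, ← ENNReal.rpow_two, ← ENNReal.rpow_two, ← ENNReal.rpow_mul, ← ENNReal.rpow_mul]
  norm_num

lemma vol_annulus_ne_top {N : ℕ} {R₀ R₁ : ℝ} (hR₀ : 0 < R₀) (hR : R₀ < R₁) :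
    volume (annulus N R₀ R₁) ≠ ⊤ :=
  ((measure_mono subset_closure).trans_lt
    (isCompact_closure_annulus hR₀ hR).measure_lt_top).ne

lemma Lk_bound (n : ℕ) (hn : 1 ≤ n) (R₀ R₁ : ℝ) (hR₀ : 0 < R₀) (hR : R₀ < R₁) (M : ℝ) (k : ℕ) :
    ∃ C : ENNReal, C ≠ ⊤ ∧ ∀ u, memK (n+1) R₀ R₁ u → √(H1sq (n+1) R₀ R₁ u) ≤ M →
      ∫⁻ x in annulus (n+1) R₀ R₁, ENNReal.ofReal (u x ^ k) ^ 2 ≤ C := by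
  induction k with
  | zero =>
    refine ⟨_, vol_annulus_ne_top (N := n+1) hR₀ hR, fun u _ _ => ?_⟩
    simp
  | succ k ih =>
    obtain ⟨D, hD, hDu⟩ := ih
    obtain ⟨C, hC, hCu⟩ := key_ineq n hn R₀ R₁ hR₀ hR
    refine ⟨C * (D * (ENNReal.ofReal (2*(k+1)^2) * ENNReal.ofReal (M^2))), ?_, fun u hu hM => ?_⟩
    · exact ENNReal.mul_ne_top hC (ENNReal.mul_ne_top hD
        (ENNReal.mul_ne_top ENNReal.ofReal_ne_top ENNReal.ofReal_ne_top))
    have hu1 := hu.1.1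
    have hu0 := hu.1.2.1
    have hH : H1sq (n+1) R₀ R₁ u ≤ M^2 := by
      rw [← Real.sq_sqrt (H1sq_nonneg (n+1) R₀ R₁ u)]
      exact pow_le_pow_left₀ (Real.sqrt_nonneg _) hM 2
    refine (hCu u hu k).trans ?_
    gcongr
    have e1 : ∫⁻ x in annulus (n+1) R₀ R₁, ENNReal.ofReal ((k+1) * u x ^ k *
          (u x + ‖fderivWithin ℝ u (closure (annulus (n+1) R₀ R₁)) x‖))
        = ∫⁻ x in annulus (n+1) R₀ R₁, ENNReal.ofReal (u x ^ k) * ENNReal.ofReal ((k+1) *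
          (u x + ‖fderivWithin ℝ u (closure (annulus (n+1) R₀ R₁)) x‖)) := by
      refine setLIntegral_congr_fun (measurableSet_annulus _ _ _) fun x hx => ?_
      have := hu0 x (subset_closure hx)
      rw [← ENNReal.ofReal_mul (by positivity)]
      congr 1; ring
    rw [e1]
    refine (cs_lint _ _ _ ?_ ?_).trans ?_
    · exact (((hu1.continuousOn.mono subset_closure).pow k).aemeasurable
        (measurableSet_annulus _ _ _)).ennreal_ofReal
    · refine ContinuousOn.aemeasurable ?_ (measurableSet_annulus _ _ _) |>.ennreal_ofReal
      exact (continuousOn_const.mul (hu1.continuousOn.add (cont_fdw hR₀ hR hu1).norm)).mono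
        subset_closure
    · gcongr
      · exact hDu u hu hM
      · refine le_trans ?_ (mul_le_mul_right (ENNReal.ofReal_le_ofReal hH) _)
        rw [← H1sq_lint hR₀ hR hu1, ← lintegral_const_mul' _ _ ENNReal.ofReal_ne_top]
        refine setLIntegral_mono' (measurableSet_annulus _ _ _) fun x hx => ?_
        have := hu0 x (subset_closure hx)
        rw [← ENNReal.ofReal_mul (by positivity), sq, ← ENNReal.ofReal_mul']
        · refine ENNReal.ofReal_le_ofReal ?_
          nlinarith [sq_nonneg ((k+1) * (u x - ‖fderivWithin ℝ u (closure (annulus (n+1) R₀ R₁)) x‖))]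
        · positivity

lemma Lq_bound (n : ℕ) (hn : 1 ≤ n) (R₀ R₁ : ℝ) (hR₀ : 0 < R₀) (hR : R₀ < R₁) (M : ℝ) (q : ℝ)
    (hq : 0 < q) :
    ∃ C : ℝ, 0 ≤ C ∧ ∀ u, memK (n+1) R₀ R₁ u → √(H1sq (n+1) R₀ R₁ u) ≤ M →
      ∫ x in annulus (n+1) R₀ R₁, u x ^ q ≤ C := by
  obtain ⟨k, hk⟩ := exists_nat_ge q
  obtain ⟨D, hD, hDu⟩ := Lk_bound n hn R₀ R₁ hR₀ hR M k
  refine ⟨(volume (annulus (n+1) R₀ R₁)).toReal + D.toReal, by positivity, fun u hu hM => ?_⟩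
  have hu1 := hu.1.1.continuousOn
  have hu0 := hu.1.2.1
  have i1 : IntegrableOn (fun x => (u x ^ k)^2) (annulus (n+1) R₀ R₁) :=
    intOn_annulus hR₀ hR ((hu1.pow k).pow 2)
  have i0 : IntegrableOn (fun _ => (1:ℝ)) (annulus (n+1) R₀ R₁) :=
    intOn_annulus hR₀ hR continuousOn_const
  have iq : IntegrableOn (fun x => u x ^ q) (annulus (n+1) R₀ R₁) :=
    intOn_annulus hR₀ hR (hu1.rpow_const fun x _ => Or.inr hq.le)
  have h2 : ∫ x in annulus (n+1) R₀ R₁, (u x ^ k)^2 ≤ D.toReal := by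
    rw [integral_eq_lintegral_of_nonneg_ae (Filter.Eventually.of_forall fun _ => by positivity)
      i1.aestronglyMeasurable]
    refine ENNReal.toReal_mono hD (le_trans (le_of_eq ?_) (hDu u hu hM))
    refine setLIntegral_congr_fun (measurableSet_annulus _ _ _) fun x hx => ?_
    have := hu0 x (subset_closure hx)
    rw [ENNReal.ofReal_pow (by positivity)]
  calc ∫ x in annulus (n+1) R₀ R₁, u x ^ q
      ≤ ∫ x in annulus (n+1) R₀ R₁, (1 + (u x ^ k)^2) := by
        refine setIntegral_mono_on iq (i0.add i1) (measurableSet_annulus _ _ _) fun x hx => ?_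
        have h0 := hu0 x (subset_closure hx)
        rcases le_total (u x) 1 with h | h
        · have := Real.rpow_le_one h0 h hq.le
          nlinarith [sq_nonneg (u x ^ k)]
        · have : u x ^ q ≤ u x ^ (k:ℝ) := Real.rpow_le_rpow_of_exponent_le h hk
          rw [Real.rpow_natCast] at this
          nlinarith [sq_nonneg (u x ^ k - 1)]
    _ = (volume (annulus (n+1) R₀ R₁)).toReal + ∫ x in annulus (n+1) R₀ R₁, (u x ^ k)^2 := by
        rw [integral_add i0 i1]
        simp [Measure.real]
    _ ≤ _ := by gcongr


lemma norm_sq_dual {N : ℕ} (L : EuclideanSpace ℝ (Fin N) →L[ℝ] ℝ) :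
    ‖L‖^2 = ∑ i, (L (EuclideanSpace.single i 1))^2 := by
  set y := (InnerProductSpace.toDual ℝ (EuclideanSpace ℝ (Fin N))).symm L with hy
  have h1 : ‖L‖ = ‖y‖ := by simp [hy]
  rw [h1, EuclideanSpace.norm_sq_eq]
  refine Finset.sum_congr rfl fun i _ => ?_
  have : L (EuclideanSpace.single i 1) = inner ℝ y (EuclideanSpace.single i 1) := by
    rw [hy, InnerProductSpace.toDual_symm_apply]
  rw [this, EuclideanSpace.inner_single_right]
  simp

lemma int_partial_zero {N : ℕ} (F : EuclideanSpace ℝ (Fin N) → ℝ) (hF : ContDiff ℝ 1 F)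
    (hc : HasCompactSupport F) (v : EuclideanSpace ℝ (Fin N)) : ∫ x, fderiv ℝ F x v = 0 := by
  have hcd : Continuous (fun x => fderiv ℝ F x v) :=
    (hF.continuous_fderiv one_ne_zero).clm_apply continuous_const
  have h := integral_mul_fderiv_eq_neg_fderiv_mul_of_integrable (𝕜 := ℝ) (μ := volume)
    (f := fun _ : EuclideanSpace ℝ (Fin N) => (1:ℝ)) (g := F) (v := v)
    (by simp) (by simpa using hcd.integrable_of_hasCompactSupport (hc.fderiv_apply (𝕜 := ℝ) v))
    (by simpa using hF.continuous.integrable_of_hasCompactSupport hc)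
    (fun x _ => differentiableAt_const _) (fun x _ => hF.differentiable one_ne_zero x)
  simpa using h

lemma cut_identity {N : ℕ} {R₀ R₁ : ℝ} 
    {w χ : EuclideanSpace ℝ (Fin N) → ℝ} (hw : ContDiffOn ℝ 2 w (annulus N R₀ R₁))
    (hχ : ContDiff ℝ 1 χ) (hχc : HasCompactSupport χ) (hχA : tsupport χ ⊆ annulus N R₀ R₁) :
    ∫ x in annulus N R₀ R₁, (χ x * ‖fderiv ℝ w x‖^2
      + w x * ∑ i, fderiv ℝ χ x (EuclideanSpace.single i 1) * fderiv ℝ w x (EuclideanSpace.single i 1)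
      + χ x * (w x * lapl w x)) = 0 := by
  have hop : IsOpen (annulus N R₀ R₁) := isOpen_annulus
  set F : Fin N → EuclideanSpace ℝ (Fin N) → ℝ := fun i x =>
    χ x * (w x * fderiv ℝ w x (EuclideanSpace.single i 1)) with hFdef
  have hwA : ∀ x ∈ annulus N R₀ R₁, ContDiffAt ℝ 2 w x := fun x hx =>
    hw.contDiffAt (hop.mem_nhds hx)
  have hdw : ∀ x ∈ annulus N R₀ R₁, ∀ i : Fin N,
      ContDiffAt ℝ 1 (fun y => fderiv ℝ w y (EuclideanSpace.single i 1)) x := fun x hx i => by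
    have : ContDiffAt ℝ 1 (fderiv ℝ w) x := (hwA x hx).fderiv_right (by norm_num)
    exact this.clm_apply contDiffAt_const
  have hz : ∀ x ∉ annulus N R₀ R₁, ∀ i, F i =ᶠ[nhds x] 0 := fun x hx i => by
    have : χ =ᶠ[nhds x] 0 := notMem_tsupport_iff_eventuallyEq.mp fun h => hx (hχA h)
    filter_upwards [this] with y hy
    simp [hFdef, hy]
  have hF1 : ∀ i, ContDiff ℝ 1 (F i) := fun i => by
    rw [contDiff_iff_contDiffAt]
    intro x
    by_cases hx : x ∈ annulus N R₀ R₁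
    · exact hχ.contDiffAt.mul (((hwA x hx).of_le (by norm_num)).mul (hdw x hx i))
    · exact (contDiffAt_const (c := (0:ℝ))).congr_of_eventuallyEq (hz x hx i)
  have hFc : ∀ i, HasCompactSupport (F i) := fun i => hχc.mul_right
  have h0 : ∑ i, ∫ x, fderiv ℝ (F i) x (EuclideanSpace.single i 1) = 0 :=
    Finset.sum_eq_zero fun i _ => int_partial_zero _ (hF1 i) (hFc i) _
  rw [← integral_finset_sum] at h0
  swap
  · intro i _
    exact (((hF1 i).continuous_fderiv one_ne_zero).clm_apply
      continuous_const).integrable_of_hasCompactSupport ((hFc i).fderiv_apply (𝕜 := ℝ) _)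
  rw [← h0, ← integral_indicator (measurableSet_annulus _ _ _)]
  congr 1
  funext x
  by_cases hx : x ∈ annulus N R₀ R₁
  · rw [indicator_of_mem hx, norm_sq_dual, lapl, Finset.mul_sum, Finset.mul_sum, Finset.mul_sum,
      Finset.mul_sum, ← Finset.sum_add_distrib, ← Finset.sum_add_distrib]
    refine Finset.sum_congr rfl fun i _ => ?_
    have d1 := (hχ.differentiable one_ne_zero x).hasFDerivAt
    have d2 := ((hwA x hx).differentiableAt two_ne_zero).hasFDerivAt
    have d3 := ((hdw x hx i).differentiableAt one_ne_zero).hasFDerivAt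
    have d := d1.fun_mul (d2.fun_mul d3)
    rw [d.fderiv]
    simp only [ContinuousLinearMap.add_apply, ContinuousLinearMap.smul_apply, smul_eq_mul]
    ring
  · rw [indicator_of_notMem hx]
    refine (Finset.sum_eq_zero fun i _ => ?_).symm
    rw [(hz x hx i).fderiv_eq]
    simp


/-- A smooth defining function of the annulus. -/
noncomputable def dA {N : ℕ} (R₀ R₁ : ℝ) (x : EuclideanSpace ℝ (Fin N)) : ℝ :=
  (‖x‖^2 - R₀^2) * (R₁^2 - ‖x‖^2)

lemma dA_contDiff {N : ℕ} (R₀ R₁ : ℝ) : ContDiff ℝ 1 (dA (N := N) R₀ R₁) := by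
  have : ContDiff ℝ 1 (fun x : EuclideanSpace ℝ (Fin N) => ‖x‖^2) := contDiff_norm_sq ℝ
  exact (this.sub contDiff_const).mul (contDiff_const.sub this)

lemma dA_pos_iff {N : ℕ} {R₀ R₁ : ℝ} (hR₀ : 0 < R₀) (hR : R₀ < R₁) (x : EuclideanSpace ℝ (Fin N)) :
    0 < dA R₀ R₁ x ↔ x ∈ annulus N R₀ R₁ := by
  have hx := norm_nonneg x
  unfold dA annulus
  simp only [mem_setOf_eq]
  constructor
  · intro h
    rcases pos_and_pos_or_neg_and_neg_of_mul_pos h with ⟨h1, h2⟩ | ⟨h1, h2⟩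
    · constructor <;> nlinarith
    · nlinarith
  · rintro ⟨h1, h2⟩
    apply mul_pos <;> nlinarith

lemma cutoffs {N : ℕ} {R₀ R₁ : ℝ} (hR₀ : 0 < R₀) (hR : R₀ < R₁) :
    ∃ (B : ℝ) (χ : ℕ → EuclideanSpace ℝ (Fin N) → ℝ), 0 ≤ B ∧
      (∀ m, ContDiff ℝ 1 (χ m)) ∧ (∀ m, HasCompactSupport (χ m)) ∧
      (∀ m, tsupport (χ m) ⊆ annulus N R₀ R₁) ∧ (∀ m x, |χ m x| ≤ 1) ∧
      (∀ m, ∀ x ∈ annulus N R₀ R₁, dA R₀ R₁ x * ‖fderiv ℝ (χ m) x‖ ≤ B) ∧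
      (∀ x ∈ annulus N R₀ R₁, ∀ᶠ m in Filter.atTop, χ m x = 1 ∧ fderiv ℝ (χ m) x = 0) := by
  have hT : ContDiff ℝ 1 smoothTransition := smoothTransition.contDiff (n := 1)
  obtain ⟨B₁, hB₁⟩ := (isCompact_Icc (a := (-1:ℝ)) (b := 1)).exists_bound_of_continuousOn
    (hT.continuous_deriv le_rfl).continuousOn
  have hd := dA_contDiff (N := N) R₀ R₁
  obtain ⟨B₂, hB₂⟩ := (isCompact_closure_annulus (N := N) hR₀ hR).exists_bound_of_continuousOn
    (hd.continuous_fderiv one_ne_zero).continuousOn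
  set χ : ℕ → EuclideanSpace ℝ (Fin N) → ℝ := fun m x => smoothTransition (m * dA R₀ R₁ x - 1)
    with hχ
  have hsupp : ∀ m, tsupport (χ m) ⊆ annulus N R₀ R₁ := by
    intro m
    have : tsupport (χ m) ⊆ {x | 1 ≤ m * dA R₀ R₁ x} := by
      refine closure_minimal ?_ (isClosed_le continuous_const (continuous_const.mul hd.continuous))
      intro x hx
      by_contra hlt
      simp only [mem_setOf_eq, not_le] at hlt
      exact hx (smoothTransition.zero_of_nonpos (by linarith))
    intro x hx
    rw [← dA_pos_iff hR₀ hR]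
    have h1 : 1 ≤ m * dA R₀ R₁ x := this hx
    by_contra hle
    have : (m:ℝ) * dA R₀ R₁ x ≤ 0 := mul_nonpos_of_nonneg_of_nonpos (by positivity) (not_lt.mp hle)
    linarith
  have hflat : ∀ (m : ℕ) (x : EuclideanSpace ℝ (Fin N)), 2 < m * dA R₀ R₁ x → χ m x = 1 ∧ fderiv ℝ (χ m) x = 0 := by
    intro m x h
    have : χ m =ᶠ[nhds x] fun _ => 1 := by
      filter_upwards [(isOpen_lt continuous_const (continuous_const.mul hd.continuous)).mem_nhds h]
        with y hy
      change 2 < (m:ℝ) * dA R₀ R₁ y at hy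
      exact smoothTransition.one_of_one_le (by linarith)
    exact ⟨this.eq_of_nhds, by rw [this.fderiv_eq]; simp⟩
  refine ⟨2 * max B₁ 0 * max B₂ 0, χ, by positivity, ?_, ?_, hsupp, ?_, ?_, ?_⟩
  · exact fun m => hT.comp ((contDiff_const.mul hd).sub contDiff_const)
  · intro m
    exact HasCompactSupport.intro' (isCompact_closure_annulus (N := N) hR₀ hR)
      isClosed_closure fun x hx => by
        by_contra hne
        exact hx (subset_closure (hsupp m (subset_tsupport _ hne)))
  · intro m x
    rw [abs_of_nonneg (smoothTransition.nonneg _)]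
    exact smoothTransition.le_one _
  · intro m x hx
    have hdx : 0 < dA R₀ R₁ x := (dA_pos_iff hR₀ hR x).mpr hx
    by_cases h : 2 < m * dA R₀ R₁ x
    · rw [(hflat m x h).2]; simp; positivity
    · push Not at h
      have hder : HasFDerivAt (χ m) ((deriv smoothTransition (m * dA R₀ R₁ x - 1)) •
          ((m:ℝ) • fderiv ℝ (dA R₀ R₁) x)) x := by
        have h1 := (hT.differentiable one_ne_zero (m * dA R₀ R₁ x - 1)).hasDerivAt
        have h2 := (((hd.differentiable one_ne_zero x).hasFDerivAt).const_mul (m:ℝ)).sub_const 1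
        exact h1.comp_hasFDerivAt x h2
      rw [hder.fderiv, norm_smul, norm_smul]
      have b1 : ‖deriv smoothTransition (m * dA R₀ R₁ x - 1)‖ ≤ max B₁ 0 :=
        (hB₁ _ ⟨by nlinarith [mul_nonneg (Nat.cast_nonneg (α := ℝ) m) hdx.le], by linarith⟩).trans (le_max_left _ _)
      have b2 : ‖fderiv ℝ (dA R₀ R₁) x‖ ≤ max B₂ 0 :=
        (hB₂ _ (subset_closure hx)).trans (le_max_left _ _)
      have b3 : ‖(m:ℝ)‖ = m := by simp
      rw [b3]
      calc dA R₀ R₁ x * (‖deriv smoothTransition (m * dA R₀ R₁ x - 1)‖ * (m * ‖fderiv ℝ (dA R₀ R₁) x‖))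
          = (m * dA R₀ R₁ x) * ‖deriv smoothTransition (m * dA R₀ R₁ x - 1)‖ * ‖fderiv ℝ (dA R₀ R₁) x‖ := by ring
        _ ≤ 2 * max B₁ 0 * max B₂ 0 := by gcongr
  · intro x hx
    have hdx : 0 < dA R₀ R₁ x := (dA_pos_iff hR₀ hR x).mpr hx
    obtain ⟨m₀, hm₀⟩ := exists_nat_gt (2 / dA R₀ R₁ x)
    filter_upwards [Filter.eventually_ge_atTop m₀] with m hm
    apply hflat
    rw [div_lt_iff₀ hdx] at hm₀
    have : (m₀:ℝ) ≤ m := by exact_mod_cast hm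
    nlinarith

lemma dist_bound {N : ℕ} {R₀ R₁ : ℝ} (hR₀ : 0 < R₀) (hR : R₀ < R₁)
    {w : EuclideanSpace ℝ (Fin N) → ℝ} (hw : ContDiffOn ℝ 1 w (closure (annulus N R₀ R₁)))
    (hw0 : ∀ x : EuclideanSpace ℝ (Fin N), (‖x‖ = R₀ ∨ ‖x‖ = R₁) → w x = 0) :
    ∃ C : ℝ, 0 ≤ C ∧ ∀ x ∈ annulus N R₀ R₁, |w x| ≤ C * dA R₀ R₁ x := by
  obtain ⟨B₀, hB₀⟩ := (isCompact_closure_annulus (N := N) hR₀ hR).exists_bound_of_continuousOn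
    (cont_fdw hR₀ hR hw)
  set B := max B₀ 0 with hB
  have hBn : 0 ≤ B := le_max_right _ _
  have hδ : 0 < R₁ - R₀ := by linarith
  refine ⟨B * (2 / (R₁ - R₀)) * (1 / R₀^2), by positivity, fun x hx => ?_⟩
  have hxn : 0 < ‖x‖ := hR₀.trans hx.1
  set ω := (‖x‖)⁻¹ • x with hω
  have hωn : ‖ω‖ = 1 := by rw [hω, norm_smul, norm_inv, norm_norm]; field_simp
  have hxω : ‖x‖ • ω = x := by rw [hω, smul_smul, mul_inv_cancel₀ hxn.ne', one_smul]
  have hmem : ∀ t ∈ Icc R₀ R₁, t • ω ∈ closure (annulus N R₀ R₁) := by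
    intro t ht
    rw [closure_annulus hR₀ hR]
    have : ‖t • ω‖ = t := by rw [norm_smul, hωn, mul_one, Real.norm_of_nonneg (hR₀.le.trans ht.1)]
    exact ⟨this.symm ▸ ht.1, this.symm ▸ ht.2⟩
  have hder : ∀ t ∈ Icc R₀ R₁, HasDerivWithinAt (fun t : ℝ => w (t • ω))
      (fderivWithin ℝ w (closure (annulus N R₀ R₁)) (t • ω) ω) (Icc R₀ R₁) t := by
    intro t ht
    have h1 := (hw.differentiableOn one_ne_zero _ (hmem t ht)).hasFDerivWithinAt
    have h2 : HasDerivWithinAt (fun t : ℝ => t • ω) ω (Icc R₀ R₁) t := by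
      simpa using ((hasDerivAt_id t).smul_const ω).hasDerivWithinAt
    exact h1.comp_hasDerivWithinAt t h2 (fun s hs => hmem s hs)
  have hbd : ∀ t ∈ Icc R₀ R₁, ‖fderivWithin ℝ w (closure (annulus N R₀ R₁)) (t • ω) ω‖ ≤ B := by
    intro t ht
    refine (ContinuousLinearMap.le_opNorm _ _).trans ?_
    rw [hωn, mul_one]
    exact (hB₀ _ (hmem t ht)).trans (le_max_left _ _)
  have hrI : ‖x‖ ∈ Icc R₀ R₁ := ⟨hx.1.le, hx.2.le⟩
  have hn : ∀ t, 0 < t → ‖t • ω‖ = t := fun t ht => by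
    rw [norm_smul, hωn, mul_one, Real.norm_of_nonneg ht.le]
  have k1 := (convex_Icc R₀ R₁).norm_image_sub_le_of_norm_hasDerivWithin_le hder hbd
    (left_mem_Icc.mpr hR.le) hrI
  have k2 := (convex_Icc R₀ R₁).norm_image_sub_le_of_norm_hasDerivWithin_le hder hbd
    (right_mem_Icc.mpr hR.le) hrI
  simp only [hxω] at k1 k2
  rw [hw0 (R₀ • ω) (Or.inl (hn _ hR₀)), sub_zero, Real.norm_eq_abs, Real.norm_eq_abs,
    abs_of_nonneg (sub_nonneg.mpr hx.1.le)] at k1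
  rw [hw0 (R₁ • ω) (Or.inr (hn _ (hR₀.trans hR))), sub_zero, Real.norm_eq_abs, Real.norm_eq_abs,
    abs_sub_comm, abs_of_nonneg (sub_nonneg.mpr hx.2.le)] at k2
  set r := ‖x‖ with hr
  have a1 : 0 < r - R₀ := sub_pos.mpr hx.1
  have a2 : 0 < R₁ - r := sub_pos.mpr hx.2
  have k3 : |w x| ≤ B * (2 / (R₁ - R₀)) * ((r - R₀) * (R₁ - r)) := by
    rcases le_total (r - R₀) (R₁ - r) with h | h
    · refine k1.trans ?_
      have : 1 ≤ 2 / (R₁ - R₀) * (R₁ - r) := by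
        rw [div_mul_eq_mul_div, le_div_iff₀ hδ]; linarith
      calc B * (r - R₀) = B * (r - R₀) * 1 := by ring
        _ ≤ B * (r - R₀) * (2 / (R₁ - R₀) * (R₁ - r)) := by gcongr
        _ = _ := by ring
    · refine k2.trans ?_
      have : 1 ≤ 2 / (R₁ - R₀) * (r - R₀) := by
        rw [div_mul_eq_mul_div, le_div_iff₀ hδ]; linarith
      calc B * (R₁ - r) = B * (R₁ - r) * 1 := by ring
        _ ≤ B * (R₁ - r) * (2 / (R₁ - R₀) * (r - R₀)) := by gcongr
        _ = _ := by ring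
  refine k3.trans ?_
  rw [mul_assoc (B * _)]
  refine mul_le_mul_of_nonneg_left ?_ (by positivity)
  unfold dA
  rw [← hr, one_div, inv_mul_eq_div, le_div_iff₀ (by positivity)]
  have h5 : R₀^2 ≤ (r + R₀) * (R₁ + r) := by nlinarith
  calc (r - R₀) * (R₁ - r) * R₀^2 ≤ (r - R₀) * (R₁ - r) * ((r + R₀) * (R₁ + r)) := by gcongr
    _ = _ := by ring


lemma energy {N : ℕ} {R₀ R₁ : ℝ} (hR₀ : 0 < R₀) (hR : R₀ < R₁)
    {w f : EuclideanSpace ℝ (Fin N) → ℝ} (hw : ContDiffOn ℝ 2 w (closure (annulus N R₀ R₁)))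
    (hw0 : ∀ x : EuclideanSpace ℝ (Fin N), (‖x‖ = R₀ ∨ ‖x‖ = R₁) → w x = 0)
    (hf : ContinuousOn f (closure (annulus N R₀ R₁)))
    (heq : ∀ x ∈ annulus N R₀ R₁, -lapl w x + w x = f x) :
    H1sq N R₀ R₁ w = ∫ x in annulus N R₀ R₁, f x * w x := by
  have hop : IsOpen (annulus N R₀ R₁) := isOpen_annulus
  have hmA := measurableSet_annulus N R₀ R₁
  have hcpt := isCompact_closure_annulus (N := N) hR₀ hR
  have hw1 : ContDiffOn ℝ 1 w (closure (annulus N R₀ R₁)) := hw.of_le (by norm_num)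
  set D := fderivWithin ℝ w (closure (annulus N R₀ R₁)) with hD
  have hDc : ContinuousOn D (closure (annulus N R₀ R₁)) := cont_fdw hR₀ hR hw1
  have hDe : ∀ x ∈ annulus N R₀ R₁, fderiv ℝ w x = D x := fun x hx =>
    (fderivWithin_of_mem_nhds (Filter.mem_of_superset (hop.mem_nhds hx) subset_closure)).symm
  have hwc := hw.continuousOn
  obtain ⟨B, χ, hB, hχ1, hχc, hχs, hχb, hχd, hχl⟩ := cutoffs (N := N) hR₀ hR
  obtain ⟨C, hC, hCw⟩ := dist_bound hR₀ hR hw1 hw0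
  obtain ⟨b1, hb1⟩ := hcpt.exists_bound_of_continuousOn hDc
  obtain ⟨b2, hb2⟩ := hcpt.exists_bound_of_continuousOn (hwc.mul (hwc.sub hf))
  set G : ℕ → EuclideanSpace ℝ (Fin N) → ℝ := fun m x => χ m x * ‖D x‖^2
      + w x * ∑ i, fderiv ℝ (χ m) x (EuclideanSpace.single i 1) * D x (EuclideanSpace.single i 1)
      + χ m x * (w x * (w x - f x)) with hG
  have hG0 : ∀ m, ∫ x in annulus N R₀ R₁, G m x = 0 := by
    intro m
    rw [← cut_identity (hw.mono subset_closure) (hχ1 m) (hχc m) (hχs m)]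
    refine setIntegral_congr_fun hmA fun x hx => ?_
    have : lapl w x = w x - f x := by linarith [heq x hx]
    simp only [hG, hDe x hx, this]
  have hlim : Filter.Tendsto (fun m => ∫ x in annulus N R₀ R₁, G m x) Filter.atTop
      (nhds (∫ x in annulus N R₀ R₁, (‖D x‖^2 + w x * (w x - f x)))) := by
    refine tendsto_integral_of_dominated_convergence
      (fun _ => b1^2 + N * (C * B * b1) + b2) ?_ ?_ ?_ ?_
    · intro m
      refine ContinuousOn.aestronglyMeasurable ?_ hmA
      refine ContinuousOn.mono ?_ (subset_closure : annulus N R₀ R₁ ⊆ _)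
      have c1 := (hχ1 m).continuous.continuousOn (s := closure (annulus N R₀ R₁))
      refine ((c1.mul (hDc.norm.pow 2)).add (hwc.mul ?_)).add (c1.mul (hwc.mul (hwc.sub hf)))
      refine continuousOn_finset_sum _ fun i _ => ?_
      exact (((hχ1 m).continuous_fderiv one_ne_zero).clm_apply continuous_const).continuousOn.mul
        (hDc.clm_apply continuousOn_const)
    · exact intOn_annulus hR₀ hR continuousOn_const
    · intro m
      refine (ae_restrict_iff' hmA).mpr (Filter.Eventually.of_forall fun x hx => ?_)
      have hxS := subset_closure hx
      have e1 := hb1 x hxS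
      have e2 := hb2 x hxS
      have e3 := hχb m x
      have t1 : |χ m x * ‖D x‖^2| ≤ b1^2 := by
        rw [abs_mul, abs_of_nonneg (sq_nonneg ‖D x‖)]
        calc |χ m x| * ‖D x‖^2 ≤ 1 * b1^2 := by gcongr
          _ = _ := one_mul _
      have t3 : |χ m x * (w x * (w x - f x))| ≤ b2 := by
        rw [abs_mul]
        calc |χ m x| * |w x * (w x - f x)| ≤ 1 * b2 := by
                gcongr
                exact e2
          _ = _ := one_mul _
      have t2 : |w x * ∑ i, fderiv ℝ (χ m) x (EuclideanSpace.single i 1) *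
          D x (EuclideanSpace.single i 1)| ≤ N * (C * B * b1) := by
        rw [Finset.mul_sum]
        refine (Finset.abs_sum_le_sum_abs _ _).trans ?_
        have : ∀ i ∈ (Finset.univ : Finset (Fin N)), |w x * (fderiv ℝ (χ m) x (EuclideanSpace.single i 1) *
          D x (EuclideanSpace.single i 1))| ≤ C * B * b1 := by
          intro i _
          have g1 := (fderiv ℝ (χ m) x).le_opNorm (EuclideanSpace.single i 1)
          have g2 := (D x).le_opNorm (EuclideanSpace.single i 1)
          simp only [PiLp.norm_single, norm_one, mul_one, Real.norm_eq_abs] at g1 g2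
          rw [abs_mul, abs_mul]
          calc |w x| * (|fderiv ℝ (χ m) x (EuclideanSpace.single i 1)| * |D x (EuclideanSpace.single i 1)|)
              ≤ (C * dA R₀ R₁ x) * (‖fderiv ℝ (χ m) x‖ * b1) := by
                have := (dA_pos_iff hR₀ hR x).mpr hx
                have := hCw x hx
                have := g2.trans e1
                gcongr
            _ = C * (dA R₀ R₁ x * ‖fderiv ℝ (χ m) x‖) * b1 := by ring
            _ ≤ C * B * b1 := by
                have := hχd m x hx
                have : 0 ≤ b1 := (norm_nonneg _).trans e1
                gcongr
        refine (Finset.sum_le_card_nsmul _ _ _ this).trans_eq ?_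
        simp
      rw [Real.norm_eq_abs]
      refine (abs_add_three _ _ _).trans ?_
      gcongr
    · refine (ae_restrict_iff' hmA).mpr (Filter.Eventually.of_forall fun x hx => ?_)
      refine tendsto_nhds_of_eventually_eq ?_
      filter_upwards [hχl x hx] with m hm
      simp only [hG, hm.1, hm.2]
      simp
  simp only [hG0] at hlim
  have h0 := tendsto_nhds_unique tendsto_const_nhds hlim
  have i1 : IntegrableOn (fun x => ‖D x‖^2 + w x ^2) (annulus N R₀ R₁) :=
    intOn_annulus hR₀ hR ((hDc.norm.pow 2).add (hwc.pow 2))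
  have i2 : IntegrableOn (fun x => f x * w x) (annulus N R₀ R₁) :=
    intOn_annulus hR₀ hR (hf.mul hwc)
  have : ∫ x in annulus N R₀ R₁, (‖D x‖^2 + w x * (w x - f x))
      = (∫ x in annulus N R₀ R₁, (‖D x‖^2 + w x ^2)) - ∫ x in annulus N R₀ R₁, f x * w x := by
    rw [← integral_sub i1 i2]
    congr 1
    funext x
    ring
  rw [this] at h0
  unfold H1sq
  linarith

lemma lapl_sub {N : ℕ} {R₀ R₁ : ℝ} {v w : EuclideanSpace ℝ (Fin N) → ℝ}
    (hv : ContDiffOn ℝ 2 v (annulus N R₀ R₁)) (hw : ContDiffOn ℝ 2 w (annulus N R₀ R₁))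
    {x : EuclideanSpace ℝ (Fin N)} (hx : x ∈ annulus N R₀ R₁) :
    lapl (fun x => v x - w x) x = lapl v x - lapl w x := by
  have hop : IsOpen (annulus N R₀ R₁) := isOpen_annulus
  unfold lapl
  rw [← Finset.sum_sub_distrib]
  refine Finset.sum_congr rfl fun i _ => ?_
  have hd : ∀ {g : EuclideanSpace ℝ (Fin N) → ℝ}, ContDiffOn ℝ 2 g (annulus N R₀ R₁) →
      DifferentiableAt ℝ (fun y => fderiv ℝ g y (EuclideanSpace.single i 1)) x := fun hg => by
    have h1 : ContDiffAt ℝ 1 (fderiv ℝ _) x :=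
      (hg.contDiffAt (hop.mem_nhds hx)).fderiv_right (by norm_num)
    exact (h1.clm_apply contDiffAt_const).differentiableAt one_ne_zero
  have he : (fun y => fderiv ℝ (fun x => v x - w x) y (EuclideanSpace.single i 1)) =ᶠ[nhds x]
      fun y => fderiv ℝ v y (EuclideanSpace.single i 1) - fderiv ℝ w y (EuclideanSpace.single i 1) := by
    filter_upwards [hop.mem_nhds hx] with y hy
    rw [fderiv_fun_sub ((hv.contDiffAt (hop.mem_nhds hy)).differentiableAt two_ne_zero)
      ((hw.contDiffAt (hop.mem_nhds hy)).differentiableAt two_ne_zero)]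
    rfl
  rw [he.fderiv_eq, fderiv_fun_sub (hd hv) (hd hw)]
  rfl


lemma rpow_diff_aux {x y q : ℝ} (hy : 0 ≤ y) (hyx : y ≤ x) (hq : 1 ≤ q) :
    x^q - y^q ≤ q * x^(q-1) * (x - y) := by
  rcases eq_or_lt_of_le (hy.trans hyx) with h | hx
  · have : y = 0 := le_antisymm (h ▸ hyx) hy
    rw [this, ← h]; simp
  have h1 := one_add_mul_self_le_rpow_one_add (s := y / x - 1) (by
    have : 0 ≤ y / x := by positivity
    linarith) hq
  rw [add_sub_cancel, Real.div_rpow hy hx.le, le_div_iff₀ (by positivity)] at h1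
  have h2 : x^q = x^(q-1) * x := by
    rw [← Real.rpow_add_one hx.ne']; congr 1; ring
  have h3 : (1 + q * (y/x - 1)) * x^q = x^q + q * x^(q-1) * (y - x) := by
    rw [add_mul, one_mul]
    congr 1
    nth_rw 1 [h2]
    field_simp
  rw [h3] at h1
  linarith

lemma rpow_diff {x y q : ℝ} (hx : 0 ≤ x) (hy : 0 ≤ y) (hq : 1 ≤ q) :
    |x^q - y^q| ≤ q * (x^(q-1) + y^(q-1)) * |x - y| := by
  have px : 0 ≤ x^(q-1) := by positivity
  have py : 0 ≤ y^(q-1) := by positivity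
  rcases le_total y x with h | h
  · rw [abs_of_nonneg (sub_nonneg.mpr (Real.rpow_le_rpow hy h (by linarith))),
      abs_of_nonneg (sub_nonneg.mpr h)]
    refine (rpow_diff_aux hy h hq).trans ?_
    have : 0 ≤ x - y := sub_nonneg.mpr h
    gcongr
    linarith
  · rw [abs_sub_comm, abs_sub_comm x, abs_of_nonneg (sub_nonneg.mpr (Real.rpow_le_rpow hx h (by linarith))),
      abs_of_nonneg (sub_nonneg.mpr h)]
    refine (rpow_diff_aux hx h hq).trans ?_
    have : 0 ≤ y - x := sub_nonneg.mpr h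
    gcongr
    linarith

lemma holderA {N : ℕ} {R₀ R₁ : ℝ} (hR₀ : 0 < R₀) (hR : R₀ < R₁)
    {f g : EuclideanSpace ℝ (Fin N) → ℝ} (hf : ContinuousOn f (closure (annulus N R₀ R₁)))
    (hg : ContinuousOn g (closure (annulus N R₀ R₁)))
    (hf0 : ∀ x ∈ annulus N R₀ R₁, 0 ≤ f x) (hg0 : ∀ x ∈ annulus N R₀ R₁, 0 ≤ g x)
    {r s : ℝ} (hrs : r.HolderConjugate s) :
    ∫ x in annulus N R₀ R₁, f x * g x ≤
      (∫ x in annulus N R₀ R₁, f x ^ r) ^ (1/r) * (∫ x in annulus N R₀ R₁, g x ^ s) ^ (1/s) := by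
  have hmA := measurableSet_annulus N R₀ R₁
  have : IsFiniteMeasure (volume.restrict (annulus N R₀ R₁)) :=
    ⟨by simpa using (vol_annulus_ne_top (N := N) hR₀ hR).lt_top⟩
  have hmem : ∀ {h : EuclideanSpace ℝ (Fin N) → ℝ} {t : ENNReal},
      ContinuousOn h (closure (annulus N R₀ R₁)) → MemLp h t (volume.restrict (annulus N R₀ R₁)) := by
    intro h t hh
    obtain ⟨b, hb⟩ := (isCompact_closure_annulus (N := N) hR₀ hR).exists_bound_of_continuousOn hh
    exact MemLp.of_bound ((hh.mono subset_closure).aestronglyMeasurable hmA) b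
      ((ae_restrict_iff' hmA).mpr (Filter.Eventually.of_forall fun x hx => hb x (subset_closure hx)))
  exact integral_mul_le_Lp_mul_Lq_of_nonneg hrs
    ((ae_restrict_iff' hmA).mpr (Filter.Eventually.of_forall hf0))
    ((ae_restrict_iff' hmA).mpr (Filter.Eventually.of_forall hg0)) (hmem hf) (hmem hg)

/-- Lipschitz-type estimate for the operator `T` on bounded subsets of `K`. -/
theorem statement12 (N : ℕ) (hN : 3 ≤ N) (R₀ R₁ : ℝ) (hR₀ : 0 < R₀) (hR : R₀ < R₁)
    (p : ℝ) (hp : 2 < p) (a : EuclideanSpace ℝ (Fin N) → ℝ)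
    (ha : memKhat N R₀ R₁ a) (hapos : ∀ x ∈ closure (annulus N R₀ R₁), 0 < a x)
    (α β : ℝ) (hα₁ : 1 < α) (hα₂ : α < 2 * N / (N - 2))
    (hβ : max (N : ℝ) (1 / (p - 2)) < β)
    (hαβ : 1 / α + 1 / β + 1 / 2 = 1) :
    ∀ M : ℝ, 0 < M → ∃ C' : ℝ, 0 < C' ∧
      ∀ u ubar v vbar : EuclideanSpace ℝ (Fin N) → ℝ,
        memK N R₀ R₁ u → memK N R₀ R₁ ubar →
        Real.sqrt (H1sq N R₀ R₁ u) ≤ M → Real.sqrt (H1sq N R₀ R₁ ubar) ≤ M →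
        ContDiffOn ℝ 2 v (closure (annulus N R₀ R₁)) →
        ContDiffOn ℝ 2 vbar (closure (annulus N R₀ R₁)) →
        (∀ x : EuclideanSpace ℝ (Fin N), (‖x‖ = R₀ ∨ ‖x‖ = R₁) → v x = 0) →
        (∀ x : EuclideanSpace ℝ (Fin N), (‖x‖ = R₀ ∨ ‖x‖ = R₁) → vbar x = 0) →
        (∀ x ∈ annulus N R₀ R₁, -lapl v x + v x = a x * u x ^ (p - 1)) →
        (∀ x ∈ annulus N R₀ R₁, -lapl vbar x + vbar x = a x * ubar x ^ (p - 1)) →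
        Real.sqrt (H1sq N R₀ R₁ (fun x => v x - vbar x))
          ≤ C' * (∫ x in annulus N R₀ R₁, |u x - ubar x| ^ α) ^ (1 / α) := by
  intro M _
  obtain ⟨n, rfl⟩ : ∃ n, N = n + 1 := ⟨N - 1, by omega⟩
  have hmA := measurableSet_annulus (n+1) R₀ R₁
  have hβ0 : 0 < β := lt_of_le_of_lt ((Nat.cast_nonneg _).trans (le_max_left _ _)) hβ
  have hα0 : 0 < α := by linarith
  have hq : 0 < (p - 2) * β := mul_pos (by linarith) hβ0
  obtain ⟨C, hC, hCu⟩ := Lq_bound n (by omega) R₀ R₁ hR₀ hR M _ hq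
  obtain ⟨b, hb⟩ := (isCompact_closure_annulus (N := n+1) hR₀ hR).exists_bound_of_continuousOn
    ha.1.continuousOn
  have hconj : (β/2).HolderConjugate (α/2) := by
    have h1 : (β/2)⁻¹ + (α/2)⁻¹ = 1 := by
      rw [inv_div, inv_div]
      have e1 : 2/β = 2 * (1/β) := by ring
      have e2 : 2/α = 2 * (1/α) := by ring
      rw [e1, e2]; linarith
    refine ⟨by simpa using h1, by positivity, by positivity⟩
  set P := max b 0 * (p - 1) with hP
  have hP0 : 0 ≤ P := mul_nonneg (le_max_right _ _) (by linarith)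
  set E := 2^β * (C + C) with hE
  have hE0 : 0 ≤ E := by positivity
  refine ⟨P * E^(1/β) + 1, by positivity, ?_⟩
  intro u ubar v vbar hu hub hMu hMub hv hvb hv0 hvb0 hve hvbe
  have huc := hu.1.1.continuousOn
  have hubc := hub.1.1.continuousOn
  have hu0 : ∀ x ∈ annulus (n+1) R₀ R₁, 0 ≤ u x := fun x hx => hu.1.2.1 x (subset_closure hx)
  have hub0 : ∀ x ∈ annulus (n+1) R₀ R₁, 0 ≤ ubar x := fun x hx => hub.1.2.1 x (subset_closure hx)
  set w : EuclideanSpace ℝ (Fin (n+1)) → ℝ := fun x => v x - vbar x with hw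
  have hwC : ContDiffOn ℝ 2 w (closure (annulus (n+1) R₀ R₁)) := hv.sub hvb
  have hwc := hwC.continuousOn
  set f : EuclideanSpace ℝ (Fin (n+1)) → ℝ := fun x => a x * (u x ^ (p-1) - ubar x ^ (p-1)) with hf
  have hfc : ContinuousOn f (closure (annulus (n+1) R₀ R₁)) :=
    ha.1.continuousOn.mul ((huc.rpow_const fun x _ => Or.inr (by linarith)).sub
      (hubc.rpow_const fun x _ => Or.inr (by linarith)))
  have hen := energy hR₀ hR hwC (fun x hx => by simp [hw, hv0 x hx, hvb0 x hx]) hfc (by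
    intro x hx
    rw [hw, lapl_sub (hv.mono subset_closure) (hvb.mono subset_closure) hx, hf]
    have := hve x hx
    have := hvbe x hx
    simp only
    linarith)
  set g : EuclideanSpace ℝ (Fin (n+1)) → ℝ := fun x => u x ^ (p-2) + ubar x ^ (p-2) with hg
  have hgc : ContinuousOn g (closure (annulus (n+1) R₀ R₁)) :=
    (huc.rpow_const fun x _ => Or.inr (by linarith)).add
      (hubc.rpow_const fun x _ => Or.inr (by linarith))
  have hg0 : ∀ x ∈ annulus (n+1) R₀ R₁, 0 ≤ g x := fun x hx =>
    add_nonneg (Real.rpow_nonneg (hu0 x hx) _) (Real.rpow_nonneg (hub0 x hx) _)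
  set δ : EuclideanSpace ℝ (Fin (n+1)) → ℝ := fun x => |u x - ubar x| with hδ
  have hδc : ContinuousOn δ (closure (annulus (n+1) R₀ R₁)) := (huc.sub hubc).abs
  have hδ0 : ∀ x, 0 ≤ δ x := fun x => abs_nonneg _
  set J := (∫ x in annulus (n+1) R₀ R₁, δ x ^ α) ^ (1/α) with hJ
  have hIδ : 0 ≤ ∫ x in annulus (n+1) R₀ R₁, δ x ^ α :=
    integral_nonneg fun x => Real.rpow_nonneg (hδ0 x) _
  have hJ0 : 0 ≤ J := Real.rpow_nonneg hIδ _
  set W := √(H1sq (n+1) R₀ R₁ w) with hW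
  have hW0 : 0 ≤ W := Real.sqrt_nonneg _
  have hW2 : W^2 = H1sq (n+1) R₀ R₁ w := Real.sq_sqrt (H1sq_nonneg _ _ _ _)
  -- step 1
  have s1 : W^2 ≤ P * ∫ x in annulus (n+1) R₀ R₁, (g x * δ x) * |w x| := by
    rw [hW2, hen, ← integral_const_mul]
    refine setIntegral_mono_on (intOn_annulus hR₀ hR (hfc.mul hwc))
      (intOn_annulus hR₀ hR (continuousOn_const.mul ((hgc.mul hδc).mul hwc.abs))) hmA fun x hx => ?_
    refine (le_abs_self _).trans ?_
    rw [abs_mul, ← mul_assoc]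
    refine mul_le_mul_of_nonneg_right ?_ (abs_nonneg _)
    have h1 := rpow_diff (hu0 x hx) (hub0 x hx) (q := p - 1) (by linarith)
    have e : p - 1 - 1 = p - 2 := by ring
    rw [e] at h1
    have h2 : |a x| ≤ max b 0 := (hb x (subset_closure hx)).trans (le_max_left _ _)
    rw [hf, abs_mul]
    calc |a x| * |u x ^ (p-1) - ubar x ^ (p-1)|
        ≤ max b 0 * ((p-1) * (u x ^ (p-2) + ubar x ^ (p-2)) * |u x - ubar x|) := by gcongr
      _ = P * (g x * δ x) := by rw [hP, hg, hδ]; ring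
  -- step 2
  have s2 := holderA hR₀ hR (hgc.mul hδc) hwc.abs (fun x hx => mul_nonneg (hg0 x hx) (hδ0 x))
    (fun x _ => abs_nonneg _) Real.HolderConjugate.two_two
  simp only [Pi.mul_apply, Real.rpow_two, sq_abs] at s2
  have s3 : (∫ x in annulus (n+1) R₀ R₁, w x ^ 2) ^ (1/(2:ℝ)) ≤ W := by
    rw [← Real.sqrt_eq_rpow]
    refine Real.sqrt_le_sqrt ?_
    unfold H1sq
    refine integral_mono (intOn_annulus hR₀ hR (hwc.pow 2)) (intOn_annulus hR₀ hR
      (((cont_fdw hR₀ hR (hwC.of_le (by norm_num))).norm.pow 2).add (hwc.pow 2))) fun x => ?_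
    simp only
    linarith [sq_nonneg ‖fderivWithin ℝ w (closure (annulus (n+1) R₀ R₁)) x‖]
  -- step 3
  have s4 := holderA hR₀ hR (hgc.pow 2) (hδc.pow 2) (fun x _ => sq_nonneg _)
    (fun x _ => sq_nonneg _) hconj
  have r1 : ∫ x in annulus (n+1) R₀ R₁, (g x ^ 2) ^ (β/2) = ∫ x in annulus (n+1) R₀ R₁, g x ^ β := by
    refine setIntegral_congr_fun hmA fun x hx => ?_
    rw [← Real.rpow_two, ← Real.rpow_mul (hg0 x hx)]
    congr 1; ring
  have r2 : ∫ x in annulus (n+1) R₀ R₁, (δ x ^ 2) ^ (α/2) = ∫ x in annulus (n+1) R₀ R₁, δ x ^ α := by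
    refine setIntegral_congr_fun hmA fun x hx => ?_
    rw [← Real.rpow_two, ← Real.rpow_mul (hδ0 x)]
    congr 1; ring
  simp only [Pi.pow_apply] at s4
  rw [r1, r2] at s4
  have iu : ∀ {y : EuclideanSpace ℝ (Fin (n+1)) → ℝ}, ContinuousOn y (closure (annulus (n+1) R₀ R₁)) →
      IntegrableOn (fun x => y x ^ ((p-2)*β)) (annulus (n+1) R₀ R₁) := fun hy =>
    intOn_annulus hR₀ hR (hy.rpow_const fun x _ => Or.inr hq.le)
  have s5 : ∫ x in annulus (n+1) R₀ R₁, g x ^ β ≤ E := by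
    calc ∫ x in annulus (n+1) R₀ R₁, g x ^ β
        ≤ ∫ x in annulus (n+1) R₀ R₁, 2^β * (u x ^ ((p-2)*β) + ubar x ^ ((p-2)*β)) := by
          refine setIntegral_mono_on (intOn_annulus hR₀ hR (hgc.rpow_const fun x _ => Or.inr hβ0.le))
            (((iu huc).add (iu hubc)).const_mul _) hmA fun x hx => ?_
          have pu := Real.rpow_nonneg (hu0 x hx) (p-2)
          have pb := Real.rpow_nonneg (hub0 x hx) (p-2)
          rw [Real.rpow_mul (hu0 x hx), Real.rpow_mul (hub0 x hx)]
          have qu := Real.rpow_nonneg pu β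
          have qb := Real.rpow_nonneg pb β
          rcases le_total (u x ^ (p-2)) (ubar x ^ (p-2)) with h | h
          · calc g x ^ β ≤ (2 * ubar x ^ (p-2))^β :=
                  Real.rpow_le_rpow (hg0 x hx) (by simp only [hg]; linarith) hβ0.le
              _ = 2^β * (ubar x ^ (p-2))^β := Real.mul_rpow (by norm_num) pb
              _ ≤ _ := by gcongr; linarith
          · calc g x ^ β ≤ (2 * u x ^ (p-2))^β :=
                  Real.rpow_le_rpow (hg0 x hx) (by simp only [hg]; linarith) hβ0.le
              _ = 2^β * (u x ^ (p-2))^β := Real.mul_rpow (by norm_num) pu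
              _ ≤ _ := by gcongr; linarith
      _ = 2^β * ((∫ x in annulus (n+1) R₀ R₁, u x ^ ((p-2)*β))
            + ∫ x in annulus (n+1) R₀ R₁, ubar x ^ ((p-2)*β)) := by
          rw [integral_const_mul, integral_add (iu huc) (iu hubc)]
      _ ≤ E := by
          have := hCu u hu hMu
          have := hCu ubar hub hMub
          rw [hE]
          gcongr
  have hg00 : 0 ≤ ∫ x in annulus (n+1) R₀ R₁, g x ^ β :=
    setIntegral_nonneg hmA fun x hx => Real.rpow_nonneg (hg0 x hx) _
  have s6 : (∫ x in annulus (n+1) R₀ R₁, (g x * δ x)^2) ^ (1/(2:ℝ)) ≤ E^(1/β) * J := by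
    have : ∫ x in annulus (n+1) R₀ R₁, (g x * δ x)^2 ≤ (E^(1/β) * J)^2 := by
      calc ∫ x in annulus (n+1) R₀ R₁, (g x * δ x)^2
          = ∫ x in annulus (n+1) R₀ R₁, g x ^ 2 * δ x ^ 2 := by simp only [mul_pow]
        _ ≤ _ := s4
        _ ≤ E^(1/(β/2)) * (∫ x in annulus (n+1) R₀ R₁, δ x ^ α)^(1/(α/2)) := by gcongr
        _ = (E^(1/β) * J)^2 := by
          rw [mul_pow, hJ, ← Real.rpow_two, ← Real.rpow_two, ← Real.rpow_mul hE0,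
            ← Real.rpow_mul hIδ]
          congr 2 <;> field_simp
    rw [← Real.sqrt_eq_rpow]
    exact Real.sqrt_le_iff.mpr ⟨by positivity, this⟩
  have s7 : W^2 ≤ P * E^(1/β) * J * W := by
    calc W^2 ≤ _ := s1
      _ ≤ P * ((E^(1/β) * J) * W) := by
        refine mul_le_mul_of_nonneg_left (s2.trans ?_) hP0
        gcongr
      _ = _ := by ring
  have s8 : W ≤ P * E^(1/β) * J := by
    rcases eq_or_lt_of_le hW0 with h | h
    · rw [← h]; positivity
    · rw [sq] at s7
      exact le_of_mul_le_mul_right s7 h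
  calc W ≤ P * E^(1/β) * J := s8
    _ ≤ (P * E^(1/β) + 1) * J := by nlinarith
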